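/- arXiv:1205.6056 — 4 statements merged into one kernel-verified Lean document; each statement's English description precedes it below -/
import Mathlib

section
/- For all integers n ≥ 1 and k ≥ 3, Γ_2(n,k) = 7·2^{2n} + (2^{k+1} − 25)·2^n − 2^{k+1} + 18 (an identity of integers). -/
open Finset

/-- The `2n × k` n-times persymmetric matrix over `F_2` associated to a parameter tuple
`alpha ∈ (F_2^{k+1})^n` : for `1 ≤ j ≤ n`, rows `2j-1` and `2j` are
`(alpha^(j)_1, ..., alpha^(j)_k)` and `(alpha^(j)_2, ..., alpha^(j)_{k+1})`. -/
def persymMatrix (n k : ℕ) (α : Fin n → Fin (k + 1) → ZMod 2) :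
    Matrix (Fin (2 * n)) (Fin k) (ZMod 2) :=
  Matrix.of fun r c =>
    α ⟨r.val / 2, by have := r.isLt; omega⟩ ⟨r.val % 2 + c.val, by have := c.isLt; omega⟩

/-- `Gamma n k i` is the number of parameter tuples `alpha ∈ (F_2^{k+1})^n` whose associated
n-times persymmetric `2n × k` matrix over `F_2` has rank `i`. -/
noncomputable def Gamma (n k i : ℕ) : ℕ :=
  Nat.card {α : Fin n → Fin (k + 1) → ZMod 2 // (persymMatrix n k α).rank = i}

/-- First basis vector of the seven planes of sequences. -/
def bB (k : ℕ) (i : Fin 7) (c : ℕ) : ZMod 2 :=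
  match i with
  | 0 => if c = 0 then 1 else 0
  | 1 => if c = 0 then 1 else 0
  | 2 => if c % 2 = 0 then 1 else 0
  | 3 => if c % 3 = 1 then 0 else 1
  | 4 => if c = 0 then 1 else 0
  | 5 => if c < k then 1 else 0
  | 6 => if c + 1 = k then 1 else 0

/-- Second basis vector of the seven planes of sequences. -/
def cB (k : ℕ) (i : Fin 7) (c : ℕ) : ZMod 2 :=
  match i with
  | 0 => if c = 1 then 1 else 0
  | 1 => if c = 0 then 0 else 1
  | 2 => if c % 2 = 0 then 0 else 1
  | 3 => if c % 3 = 0 then 0 else 1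
  | 4 => if c = k then 1 else 0
  | 5 => if c = k then 1 else 0
  | 6 => if c = k then 1 else 0

theorem z2 (x : ZMod 2) : x = 0 ∨ x = 1 := by revert x; decide

/-- Linear independence of a pair over the field with two elements. -/
def Ind {ι : Type} (s t : ι → ZMod 2) : Prop := s ≠ 0 ∧ t ≠ 0 ∧ s ≠ t

theorem vadd_self {ι : Type} (s : ι → ZMod 2) : s + s = 0 := by
  funext j; simp [CharTwo.add_self_eq_zero]

theorem vadd_eq {ι : Type} (s t : ι → ZMod 2) (h : s + t = 0) : s = t := by
  funext j
  have := congrFun h j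
  simp only [Pi.add_apply, Pi.zero_apply] at this
  exact CharTwo.add_eq_zero.mp this

theorem Ind.eq_zero {ι : Type} {s t : ι → ZMod 2} (h : Ind s t) {e f : ZMod 2}
    (he : e • s + f • t = 0) : e = 0 ∧ f = 0 := by
  obtain ⟨h1, h2, h3⟩ := h
  rcases z2 e with rfl | rfl <;> rcases z2 f with rfl | rfl <;> simp at he ⊢
  · exact h2 he
  · exact h1 he
  · exact h3 (vadd_eq _ _ he)

def IsLine {ι : Type} (A : ℕ → ι → ZMod 2) (k : ℕ) : Prop :=
  ∃ (u : ι → ZMod 2) (x : ℕ → ZMod 2), ∀ c ≤ k, A c = x c • u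

def IsForm {ι : Type} (A : ℕ → ι → ZMod 2) (k : ℕ) : Prop :=
  ∃ (i : Fin 7) (s t : ι → ZMod 2), Ind s t ∧ ∀ c ≤ k, A c = bB k i c • s + cB k i c • t

def Dep3 {ι : Type} (A : ℕ → ι → ZMod 2) (k : ℕ) : Prop :=
  ∀ a b c, a < b → b < c → c < k → ∃ e f g : ZMod 2, ¬ (e = 0 ∧ f = 0 ∧ g = 0) ∧
    e • A a + f • A b + g • A c = 0 ∧ e • A (a+1) + f • A (b+1) + g • A (c+1) = 0

theorem line_or_form {ι : Type} {A : ℕ → ι → ZMod 2} {k : ℕ} {i : Fin 7} {s t : ι → ZMod 2}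
    (h : ∀ c ≤ k, A c = bB k i c • s + cB k i c • t) : IsLine A k ∨ IsForm A k := by
  by_cases hi : Ind s t
  · exact Or.inr ⟨i, s, t, hi, h⟩
  · left
    unfold Ind at hi
    by_cases hs : s = 0
    · exact ⟨t, cB k i, fun c hc => by rw [h c hc, hs]; simp⟩
    by_cases ht : t = 0
    · exact ⟨s, bB k i, fun c hc => by rw [h c hc, ht]; simp⟩
    have hst : s = t := by tauto
    exact ⟨s, fun c => bB k i c + cB k i c, fun c hc => by rw [h c hc, ← hst, add_smul]⟩

/-- Pairs of consecutive entries are pairwise dependent. -/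
theorem four_seq (x : ℕ → ZMod 2) (k : ℕ)
    (h : ∀ a b, a < k → b < k → (x a = 0 ∧ x (a+1) = 0) ∨ (x b = 0 ∧ x (b+1) = 0) ∨
      (x a = x b ∧ x (a+1) = x (b+1))) (hk : 2 ≤ k) :
    (∀ c ≤ k, x c = 0) ∨ (∀ c ≤ k, x c = 1) ∨ (∀ c ≤ k, x c = if c = 0 then 1 else 0) ∨
      (∀ c ≤ k, x c = if c = k then 1 else 0) := by
  have h01 : (1 : ZMod 2) ≠ 0 := by decide
  have hs : ∀ c, c + 1 < k → (x c = x (c+1) ∧ x (c+1) = x (c+2)) ∨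
     (x c = 0 ∧ x (c+1) = 0) ∨ (x (c+1) = 0 ∧ x (c+2) = 0) := by
    intro c hc
    have := h c (c+1) (by omega) hc
    tauto
  rcases z2 (x 0) with h0 | h0
  · -- all entries before k vanish
    have hz : ∀ c, c < k → x c = 0 := by
      intro c
      induction c with
      | zero => intro _; exact h0
      | succ c ih =>
        intro hc
        have := hs c hc
        have := ih (by omega)
        rcases this with _
        grind
    rcases z2 (x k) with hk0 | hk0
    · left; intro c hc
      rcases Nat.lt_or_eq_of_le hc with h' | rfl
      · exact hz c h'
      · exact hk0
    · right; right; right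
      intro c hc
      rcases Nat.lt_or_eq_of_le hc with h' | rfl
      · rw [if_neg (by omega)]; exact hz c h'
      · simpa using hk0
  · rcases z2 (x 1) with h1 | h1
    · right; right; left
      have hz : ∀ c, c < k → x (c+1) = 0 := by
        intro c
        induction c with
        | zero => intro _; exact h1
        | succ c ih =>
          intro hc
          have := ih (by omega)
          have := h 0 (c+1) (by omega) hc
          grind
      intro c hc
      rcases c with _ | c
      · simpa using h0
      · simpa using hz c (by omega)
    · right; left
      have hz : ∀ c, c < k → x c = 1 ∧ x (c+1) = 1 := by
        intro c
        induction c with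
        | zero => intro _; exact ⟨h0, h1⟩
        | succ c ih =>
          intro hc
          have := ih (by omega)
          have := hs c hc
          grind
      intro c hc
      rcases Nat.lt_or_eq_of_le hc with h' | rfl
      · exact (hz c h').1
      · have := (hz (c-1) (by omega)).2
        rwa [Nat.sub_add_cancel (by omega)] at this

theorem base_case {ι : Type} {A : ℕ → ι → ZMod 2} (h : Dep3 A 3) : IsLine A 3 ∨ IsForm A 3 := by
  obtain ⟨e, f, g, hn, h1, h2⟩ := h 0 1 2 (by omega) (by omega) (by omega)
  have key : ∀ (i : Fin 7) (s t : ι → ZMod 2),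
      (A 0 = bB 3 i 0 • s + cB 3 i 0 • t) → (A 1 = bB 3 i 1 • s + cB 3 i 1 • t) →
      (A 2 = bB 3 i 2 • s + cB 3 i 2 • t) → (A 3 = bB 3 i 3 • s + cB 3 i 3 • t) →
      IsLine A 3 ∨ IsForm A 3 := by
    intro i s t a b c d
    apply line_or_form (i := i) (s := s) (t := t)
    intro m hm
    interval_cases m <;> assumption
  rcases z2 e with rfl | rfl <;> rcases z2 f with rfl | rfl <;> rcases z2 g with rfl | rfl <;>
    simp at hn h1 h2
  · exact key 0 (A 0) (A 1) (by simp [bB, cB]) (by simp [bB, cB]) (by simp [bB, cB, h1])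
      (by simp [bB, cB, h2])
  · exact key 4 (A 0) (A 3) (by simp [bB, cB]) (by simp [bB, cB, h1]) (by simp [bB, cB, h2])
      (by simp [bB, cB])
  · have h1 := vadd_eq _ _ h1
    have h2 := vadd_eq _ _ h2
    exact key 1 (A 0) (A 1) (by simp [bB, cB]) (by simp [bB, cB]) (by simp [bB, cB, h1])
      (by simp [bB, cB, h1, h2])
  · exact key 6 (A 2) (A 3) (by simp [bB, cB, h1]) (by simp [bB, cB, h2]) (by simp [bB, cB])
      (by simp [bB, cB])
  · have h1 := vadd_eq _ _ h1
    have h2 := vadd_eq _ _ h2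
    exact key 2 (A 0) (A 1) (by simp [bB, cB]) (by simp [bB, cB]) (by simp [bB, cB, h1])
      (by simp [bB, cB, h2])
  · have h1 := vadd_eq _ _ h1
    have h2 := vadd_eq _ _ h2
    exact key 5 (A 0) (A 3) (by simp [bB, cB]) (by simp [bB, cB, h1]) (by simp [bB, cB, h1, h2])
      (by simp [bB, cB])
  · have h1 := vadd_eq _ _ h1
    have h2 := vadd_eq _ _ h2
    exact key 3 (A 0) (A 1) (by simp [bB, cB]) (by simp [bB, cB]) (by simp [bB, cB, h1])
      (by simp [bB, cB, ← h2, ← h1]; rw [add_comm (A 0), ← add_assoc, vadd_self, zero_add])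

theorem form_step {ι : Type} {A : ℕ → ι → ZMod 2} {k : ℕ} (hk : 3 ≤ k) (h : Dep3 A (k+1))
    (hf : IsForm A k) : IsForm A (k+1) := by
  obtain ⟨i, s, t, hi, hA⟩ := hf
  have h01 : (1 : ZMod 2) ≠ 0 := by decide
  have gen : ∀ i : Fin 7, bB k i 0 = 1 → cB k i 0 = 0 → bB k i 1 = 0 → cB k i 1 = 1 →
      (∀ c ≤ k, A c = bB k i c • s + cB k i c • t) →
      ∃ x y : ZMod 2, x = bB k i k ∧ y = cB k i k ∧ A (k+1) = x • A 1 + y • A 2 := by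
    intro i h1 h2 h3 h4 hA
    obtain ⟨e, f, g, hn, e1, e2⟩ := h 0 1 k (by omega) (by omega) (by omega)
    have a0 := hA 0 (by omega)
    have a1 := hA 1 (by omega)
    have ak := hA k le_rfl
    rw [h1, h2] at a0
    rw [h3, h4] at a1
    simp at a0 a1
    rw [a0, a1, ak] at e1
    have e1' : (e + g * bB k i k) • s + (f + g * cB k i k) • t = 0 := by
      rw [← e1]; module
    have := hi.eq_zero e1'
    rcases z2 g with rfl | rfl
    · simp at this; exact absurd ⟨this.1, this.2, rfl⟩ hn
    · simp only [one_mul] at this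
      refine ⟨e, f, CharTwo.add_eq_zero.mp this.1, CharTwo.add_eq_zero.mp this.2, ?_⟩
      rw [one_smul] at e2
      exact (vadd_eq _ _ e2).symm
  have fin : ∀ i : Fin 7, (∀ c ≤ k, bB (k+1) i c = bB k i c ∧ cB (k+1) i c = cB k i c) →
      (∀ c ≤ k, A c = bB k i c • s + cB k i c • t) →
      A (k+1) = bB (k+1) i (k+1) • s + cB (k+1) i (k+1) • t → IsForm A (k+1) := by
    intro i h1 hA h2
    refine ⟨i, s, t, hi, fun c hc => ?_⟩
    rcases Nat.lt_or_eq_of_le hc with h' | rfl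
    · rw [(h1 c (by omega)).1, (h1 c (by omega)).2]; exact hA c (by omega)
    · exact h2
  have a1 := hA 1 (by omega)
  have a2 := hA 2 (by omega)
  fin_cases i
  · obtain ⟨x, y, hx, hy, hh⟩ := gen 0 (by simp [bB]) (by simp [cB]) (by simp [bB]) (by simp [cB]) hA
    apply fin 0 (by simp [bB, cB]) hA
    rw [hh, hx, hy, a1, a2]
    simp [bB, cB, show k ≠ 0 by omega, show k ≠ 1 by omega]
  · obtain ⟨x, y, hx, hy, hh⟩ := gen 1 (by simp [bB]) (by simp [cB]) (by simp [bB]) (by simp [cB]) hA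
    apply fin 1 (by simp [bB, cB]) hA
    rw [hh, hx, hy, a1, a2]
    simp [bB, cB, show k ≠ 0 by omega, show k ≠ 1 by omega]
  · obtain ⟨x, y, hx, hy, hh⟩ := gen 2 (by simp [bB]) (by simp [cB]) (by simp [bB]) (by simp [cB]) hA
    apply fin 2 (by simp [bB, cB]) hA
    rw [hh, hx, hy, a1, a2]
    rcases Nat.mod_two_eq_zero_or_one k with hm | hm
    · have : (k+1) % 2 = 1 := by omega
      simp [bB, cB, hm, this]
    · have : (k+1) % 2 = 0 := by omega
      simp [bB, cB, hm, this]
  · obtain ⟨x, y, hx, hy, hh⟩ := gen 3 (by simp [bB]) (by simp [cB]) (by simp [bB]) (by simp [cB]) hA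
    apply fin 3 (by simp [bB, cB]) hA
    rw [hh, hx, hy, a1, a2]
    have : k % 3 = 0 ∨ k % 3 = 1 ∨ k % 3 = 2 := by omega
    rcases this with hm | hm | hm
    · have : (k+1) % 3 = 1 := by omega
      simp [bB, cB, hm, this]
    · have : (k+1) % 3 = 2 := by omega
      simp [bB, cB, hm, this]
    · have : (k+1) % 3 = 0 := by omega
      simp [bB, cB, hm, this]
      rw [add_comm s, ← add_assoc, vadd_self, zero_add]
  · exfalso
    obtain ⟨e, f, g, hn, e1, e2⟩ := h 0 (k-1) k (by omega) (by omega) (by omega)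
    rw [Nat.sub_add_cancel (by omega)] at e2
    rw [hA 0 (by omega), hA (k-1) (by omega), hA k le_rfl] at e1
    rw [hA 1 (by omega), hA k le_rfl] at e2
    simp [bB, cB, show k ≠ 0 by omega, show ¬ (0 = k) by omega, show ¬ (k ≤ 1) by omega, show ¬ (1 = k) by omega, show ¬ (k - 1 = 0) by omega, show ¬ (k - 1 = k) by omega] at e1 e2
    obtain ⟨rfl, rfl⟩ := hi.eq_zero e1
    simp [hi.2.1] at e2
    simp [e2] at hn
  · exfalso
    obtain ⟨e, f, g, hn, e1, e2⟩ := h 0 (k-1) k (by omega) (by omega) (by omega)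
    rw [Nat.sub_add_cancel (by omega)] at e2
    rw [hA 0 (by omega), hA (k-1) (by omega), hA k le_rfl] at e1
    rw [hA 1 (by omega), hA k le_rfl] at e2
    simp [bB, cB, show k ≠ 0 by omega, show ¬ (0 = k) by omega, show 0 < k by omega, show 1 < k by omega, show ¬ (1 = k) by omega, show k - 1 < k by omega, show ¬ (k - 1 = k) by omega] at e1 e2
    rw [← add_smul] at e1
    obtain ⟨h1, rfl⟩ := hi.eq_zero e1
    simp at e2
    obtain ⟨rfl, rfl⟩ := hi.eq_zero e2
    simp at hn
  · exfalso
    obtain ⟨e, f, g, hn, e1, e2⟩ := h (k-2) (k-1) k (by omega) (by omega) (by omega)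
    rw [Nat.sub_add_cancel (by omega), show k - 2 + 1 = k - 1 by omega] at e2
    rw [hA (k-2) (by omega), hA (k-1) (by omega), hA k le_rfl] at e1
    rw [hA (k-1) (by omega), hA k le_rfl] at e2
    simp [bB, cB, show k - 1 + 1 = k by omega, show ¬ (k - 2 + 1 = k) by omega, show ¬ (k - 1 = k) by omega, show ¬ (k - 2 = k) by omega] at e1 e2
    obtain ⟨rfl, rfl⟩ := hi.eq_zero e1
    simp [hi.1] at e2
    simp [e2] at hn

theorem line_step {ι : Type} {A : ℕ → ι → ZMod 2} {k : ℕ} (hk : 3 ≤ k) (h : Dep3 A (k+1))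
    (hl : IsLine A k) : IsLine A (k+1) ∨ IsForm A (k+1) := by
  obtain ⟨u, x, hA⟩ := hl
  have ext : ∀ (w : ι → ZMod 2) (y : ℕ → ZMod 2) (z : ZMod 2), (∀ c ≤ k, A c = y c • w) →
      A (k+1) = z • w → IsLine A (k+1) := by
    intro w y z h1 h2
    refine ⟨w, fun c => if c ≤ k then y c else z, fun c hc => ?_⟩
    rcases Nat.lt_or_eq_of_le hc with h' | rfl
    · simp only [show c ≤ k by omega, if_true]; exact h1 c (by omega)
    · simp only [show ¬ (k + 1 ≤ k) by omega, if_false]; exact h2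
  by_cases hi : Ind u (A (k+1))
  swap
  · left
    unfold Ind at hi
    by_cases hu : u = 0
    · exact ext (A (k+1)) (fun _ => 0) 1 (fun c hc => by rw [hA c hc, hu]; simp) (by simp)
    by_cases hv : A (k+1) = 0
    · exact ext u x 0 hA (by simp [hv])
    · exact ext u x 1 hA (by rw [one_smul]; tauto)
  have key : ∀ a b, a < b → b < k → (x a = 0 ∧ x (a+1) = 0) ∨ (x b = 0 ∧ x (b+1) = 0) ∨
      (x a = x b ∧ x (a+1) = x (b+1)) := by
    intro a b hab hb
    obtain ⟨e, f, g, hn, e1, e2⟩ := h a b k hab hb (by omega)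
    rw [hA a (by omega), hA b (by omega), hA k le_rfl] at e1
    rw [hA (a+1) (by omega), hA (b+1) (by omega)] at e2
    have e2' : (e * x (a+1) + f * x (b+1)) • u + g • A (k+1) = 0 := by rw [← e2]; module
    obtain ⟨h2, rfl⟩ := hi.eq_zero e2'
    have e1' : (e * x a + f * x b) • u + (0 : ZMod 2) • A (k+1) = 0 := by rw [← e1]; module
    have h1 := (hi.eq_zero e1').1
    generalize x (a+1) = p at *
    generalize x (b+1) = q at *
    generalize x a = p' at *
    generalize x b = q' at *
    clear e1 e2 e1' e2'
    revert e f p q p' q'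
    decide
  have key2 : ∀ a b, a < k → b < k → (x a = 0 ∧ x (a+1) = 0) ∨ (x b = 0 ∧ x (b+1) = 0) ∨
      (x a = x b ∧ x (a+1) = x (b+1)) := by
    intro a b ha hb
    rcases lt_trichotomy a b with h' | rfl | h'
    · exact key a b h' hb
    · tauto
    · have := key b a h' ha
      grind
  have fin : ∀ i : Fin 7, (∀ c ≤ k, x c = bB (k+1) i c ∧ cB (k+1) i c = 0) →
      bB (k+1) i (k+1) = 0 → cB (k+1) i (k+1) = 1 → IsForm A (k+1) := by
    intro i h1 h2 h3
    refine ⟨i, u, A (k+1), hi, fun c hc => ?_⟩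
    rcases Nat.lt_or_eq_of_le hc with h' | rfl
    · rw [(h1 c (by omega)).2, ← (h1 c (by omega)).1, hA c (by omega)]; simp
    · rw [h2, h3]; simp
  rcases four_seq x k key2 (by omega) with h' | h' | h' | h'
  · left
    exact ext (A (k+1)) (fun _ => 0) 1 (fun c hc => by rw [hA c hc, h' c hc]; simp) (by simp)
  · right
    refine fin 5 (fun c hc => ?_) (by simp [bB]) (by simp [cB])
    rw [h' c hc]
    simp [bB, cB, show c < k + 1 by omega, show c ≠ k + 1 by omega]
  · right
    refine fin 4 (fun c hc => ?_) (by simp [bB]) (by simp [cB])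
    rw [h' c hc]
    simp [bB, cB, show c ≠ k + 1 by omega]
  · right
    refine fin 6 (fun c hc => ?_) (by simp [bB]) (by simp [cB])
    rw [h' c hc]
    simp [bB, cB, show c ≠ k + 1 by omega]

theorem classify {ι : Type} {A : ℕ → ι → ZMod 2} {k : ℕ} (hk : 3 ≤ k) (h : Dep3 A k) :
    IsLine A k ∨ IsForm A k := by
  induction k, hk using Nat.le_induction with
  | base => exact base_case h
  | succ k hk ih =>
    have h' : Dep3 A k := fun a b c h1 h2 h3 => h a b c h1 h2 (by omega)
    rcases ih h' with hl | hf
    · exact line_step hk h hl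
    · exact Or.inr (form_step hk h hf)

/-- The sequence of coordinate vectors of a parameter tuple. -/
def seqOf {n k : ℕ} (α : Fin n → Fin (k + 1) → ZMod 2) (c : ℕ) : Fin n → ZMod 2 :=
  fun j => if h : c < k + 1 then α j ⟨c, h⟩ else 0

theorem entry_eq {n k : ℕ} (α : Fin n → Fin (k + 1) → ZMod 2) (r : Fin (2 * n)) (c : Fin k) :
    persymMatrix n k α r c = seqOf α (r.val % 2 + c.val) ⟨r.val / 2, by have := r.isLt; omega⟩ := by
  have := c.isLt
  simp [persymMatrix, seqOf, show r.val % 2 + c.val < k + 1 by omega]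

theorem rank_le_of_factor {m k d : ℕ} (M : Matrix (Fin m) (Fin k) (ZMod 2))
    (P : Fin m → Fin d → ZMod 2) (x : Fin d → Fin k → ZMod 2)
    (h : ∀ r c, M r c = ∑ i, P r i * x i c) : M.rank ≤ d := by
  have : M = (Matrix.of P) * (Matrix.of x) := by
    ext r c; rw [h, Matrix.mul_apply]; rfl
  rw [this]
  exact (Matrix.rank_mul_le_left _ _).trans (Matrix.rank_le_width _)

theorem persym_rank_le_one {n k : ℕ} (α : Fin n → Fin (k + 1) → ZMod 2) (x : ℕ → ZMod 2)
    (P0 P1 : Fin n → ZMod 2)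
    (h : ∀ c < k, seqOf α c = x c • P0 ∧ seqOf α (c+1) = x c • P1) :
    (persymMatrix n k α).rank ≤ 1 := by
  apply rank_le_of_factor _ (fun r _ => if r.val % 2 = 0 then P0 ⟨r.val / 2, by omega⟩
      else P1 ⟨r.val / 2, by omega⟩) (fun _ c => x c)
  intro r c
  rw [entry_eq]
  obtain ⟨h1, h2⟩ := h c c.isLt
  rcases Nat.mod_two_eq_zero_or_one r.val with hr | hr
  · simp [hr, h1, mul_comm]
  · simp [hr, add_comm 1, h2, mul_comm]

theorem persym_rank_le_two {n k : ℕ} (α : Fin n → Fin (k + 1) → ZMod 2) (x y : ℕ → ZMod 2)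
    (P0 P1 Q0 Q1 : Fin n → ZMod 2)
    (h : ∀ c < k, seqOf α c = x c • P0 + y c • Q0 ∧ seqOf α (c+1) = x c • P1 + y c • Q1) :
    (persymMatrix n k α).rank ≤ 2 := by
  apply rank_le_of_factor _ (fun r => ![if r.val % 2 = 0 then P0 ⟨r.val / 2, by omega⟩
      else P1 ⟨r.val / 2, by omega⟩, if r.val % 2 = 0 then Q0 ⟨r.val / 2, by omega⟩
      else Q1 ⟨r.val / 2, by omega⟩]) ![fun c => x c, fun c => y c]
  intro r c
  rw [entry_eq]
  obtain ⟨h1, h2⟩ := h c c.isLt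
  rcases Nat.mod_two_eq_zero_or_one r.val with hr | hr
  · simp [hr, h1, mul_comm, Fin.sum_univ_two]
  · simp [hr, add_comm 1, h2, mul_comm, Fin.sum_univ_two]

theorem le_rank {m k d : ℕ} (M : Matrix (Fin m) (Fin k) (ZMod 2)) (v : Fin d → Fin k)
    (h : LinearIndependent (ZMod 2) (fun i => M.col (v i))) : d ≤ M.rank := by
  rw [Matrix.rank_eq_finrank_span_cols]
  have := finrank_span_eq_card h
  rw [Fintype.card_fin] at this
  rw [← this]
  apply Submodule.finrank_mono
  apply Submodule.span_mono
  rintro _ ⟨i, rfl⟩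
  exact ⟨v i, rfl⟩

theorem comb_split {n k d : ℕ} (α : Fin n → Fin (k + 1) → ZMod 2) (v : Fin d → Fin k)
    (e : Fin d → ZMod 2) (h : ∑ i, e i • (persymMatrix n k α).col (v i) = 0) :
    ∑ i, e i • seqOf α (v i) = 0 ∧ ∑ i, e i • seqOf α ((v i).val + 1) = 0 := by
  constructor
  · funext j
    have := congrFun h ⟨2 * j.val, by omega⟩
    simp only [Finset.sum_apply, Pi.smul_apply, Matrix.col_apply, entry_eq] at this
    simpa using this
  · funext j
    have := congrFun h ⟨2 * j.val + 1, by omega⟩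
    simp only [Finset.sum_apply, Pi.smul_apply, Matrix.col_apply, entry_eq] at this
    simpa [Nat.add_mod, add_comm 1, show (2 * j.val + 1) / 2 = j.val by omega] using this

theorem two_le_rank {n k : ℕ} (α : Fin n → Fin (k + 1) → ZMod 2) (a b : ℕ) (ha : a < k) (hb : b < k)
    (h : ∀ e f : ZMod 2, e • seqOf α a + f • seqOf α b = 0 →
      e • seqOf α (a+1) + f • seqOf α (b+1) = 0 → e = 0 ∧ f = 0) :
    2 ≤ (persymMatrix n k α).rank := by
  apply le_rank _ ![⟨a, ha⟩, ⟨b, hb⟩]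
  rw [Fintype.linearIndependent_iff]
  intro g hg
  have := comb_split α _ g hg
  simp only [Fin.sum_univ_two, Matrix.cons_val_zero, Matrix.cons_val_one] at this
  have := h _ _ this.1 this.2
  intro i
  fin_cases i
  · exact this.1
  · exact this.2

theorem dep3_of_rank {n k : ℕ} (α : Fin n → Fin (k + 1) → ZMod 2)
    (h : (persymMatrix n k α).rank ≤ 2) : Dep3 (seqOf α) k := by
  intro a b c hab hbc hc
  by_contra hcon
  push Not at hcon
  have : 3 ≤ (persymMatrix n k α).rank := by
    apply le_rank _ ![⟨a, by omega⟩, ⟨b, by omega⟩, ⟨c, hc⟩]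
    rw [Fintype.linearIndependent_iff]
    intro g hg
    have := comb_split α _ g hg
    simp only [Fin.sum_univ_three, Matrix.cons_val_zero, Matrix.cons_val_one,
      Matrix.cons_val_two, Matrix.cons_val] at this
    by_contra hne
    refine hcon (g 0) (g 1) (g 2) ?_ this.1 this.2
    intro h0 h1 h2
    apply hne
    intro i
    fin_cases i
    · exact h0
    · exact h1
    · exact h2
  omega

theorem form_rank {n k : ℕ} (hk : 3 ≤ k) (α : Fin n → Fin (k + 1) → ZMod 2) (i : Fin 7)
    (s t : Fin n → ZMod 2) (hi : Ind s t)
    (hA : ∀ c ≤ k, seqOf α c = bB k i c • s + cB k i c • t) :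
    (persymMatrix n k α).rank = 2 := by
  apply le_antisymm
  · fin_cases i
    · apply persym_rank_le_two α (bB k 0) (cB k 0) s t t 0
      intro c hc
      refine ⟨hA c (by omega), ?_⟩
      rw [hA (c+1) (by omega)]
      simp [bB, cB]
    · apply persym_rank_le_two α (bB k 1) (cB k 1) s t t t
      intro c hc
      refine ⟨hA c (by omega), ?_⟩
      rw [hA (c+1) (by omega)]
      by_cases h0 : c = 0 <;> simp [bB, cB, h0]
    · apply persym_rank_le_two α (bB k 2) (cB k 2) s t t s
      intro c hc
      refine ⟨hA c (by omega), ?_⟩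
      rw [hA (c+1) (by omega)]
      rcases Nat.mod_two_eq_zero_or_one c with hm | hm
      · have : (c+1) % 2 = 1 := by omega
        simp [bB, cB, hm, this]
      · have : (c+1) % 2 = 0 := by omega
        simp [bB, cB, hm, this]
    · apply persym_rank_le_two α (bB k 3) (cB k 3) s t t (s + t)
      intro c hc
      refine ⟨hA c (by omega), ?_⟩
      rw [hA (c+1) (by omega)]
      have : c % 3 = 0 ∨ c % 3 = 1 ∨ c % 3 = 2 := by omega
      rcases this with hm | hm | hm
      · have : (c+1) % 3 = 1 := by omega
        simp [bB, cB, hm, this]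
      · have : (c+1) % 3 = 2 := by omega
        simp [bB, cB, hm, this]
      · have : (c+1) % 3 = 0 := by omega
        simp [bB, cB, hm, this]
        rw [add_comm s, ← add_assoc, vadd_self, zero_add]
    · apply persym_rank_le_two α (fun c => if c = 0 then 1 else 0) (fun c => if c + 1 = k then 1 else 0) s 0 0 t
      intro c hc
      rw [hA (c+1) (by omega), hA c (by omega)]
      simp [bB, cB, show c ≠ k by omega]
    · apply persym_rank_le_two α (fun c => if c + 1 < k then 1 else 0) (fun c => if c + 1 = k then 1 else 0) s s s t
      intro c hc
      rw [hA (c+1) (by omega), hA c (by omega)]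
      by_cases h1 : c + 1 = k
      · simp [bB, cB, h1, show c ≠ k by omega, hc]
      · simp [bB, cB, h1, show c ≠ k by omega, show c + 1 < k by omega, hc]
    · apply persym_rank_le_two α (fun c => if c + 2 = k then 1 else 0) (fun c => if c + 1 = k then 1 else 0) 0 s s t
      intro c hc
      rw [hA (c+1) (by omega), hA c (by omega)]
      simp [bB, cB, show c ≠ k by omega]
  · have gen : ∀ i : Fin 7, bB k i 0 = 1 → cB k i 0 = 0 → bB k i 1 = 0 → cB k i 1 = 1 →
        (∀ c ≤ k, seqOf α c = bB k i c • s + cB k i c • t) →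
        2 ≤ (persymMatrix n k α).rank := by
      intro i h1 h2 h3 h4 hA
      apply two_le_rank α 0 1 (by omega) (by omega)
      intro e f h _
      rw [hA 0 (by omega), hA 1 (by omega), h1, h2, h3, h4] at h
      apply hi.eq_zero
      simpa using h
    fin_cases i
    · exact gen 0 (by simp [bB]) (by simp [cB]) (by simp [bB]) (by simp [cB]) hA
    · exact gen 1 (by simp [bB]) (by simp [cB]) (by simp [bB]) (by simp [cB]) hA
    · exact gen 2 (by simp [bB]) (by simp [cB]) (by simp [bB]) (by simp [cB]) hA
    · exact gen 3 (by simp [bB]) (by simp [cB]) (by simp [bB]) (by simp [cB]) hA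
    · apply two_le_rank α 0 (k-1) (by omega) (by omega)
      intro e f h1 h2
      rw [Nat.sub_add_cancel (by omega)] at h2
      rw [hA 0 (by omega), hA (k-1) (by omega)] at h1
      rw [hA (0+1) (by omega), hA k le_rfl] at h2
      simp [bB, cB, show ¬ (0 = k) by omega, show ¬ (k = 0) by omega, show ¬ (1 = k) by omega,
        show ¬ (k - 1 = 0) by omega, show ¬ (k - 1 = k) by omega, hi.1, hi.2.1] at h1 h2
      exact ⟨h1, h2⟩
    · apply two_le_rank α 0 (k-1) (by omega) (by omega)
      intro e f h1 h2
      rw [Nat.sub_add_cancel (by omega)] at h2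
      rw [hA (0+1) (by omega), hA k le_rfl] at h2
      simp [bB, cB, show 1 < k by omega, show ¬ (1 = k) by omega] at h2
      exact hi.eq_zero h2
    · apply two_le_rank α (k-2) (k-1) (by omega) (by omega)
      intro e f h1 h2
      rw [Nat.sub_add_cancel (by omega), show k - 2 + 1 = k - 1 by omega] at h2
      rw [hA (k-1) (by omega), hA k le_rfl] at h2
      simp [bB, cB, show k - 1 + 1 = k by omega, show ¬ (k - 1 = k) by omega] at h2
      exact hi.eq_zero h2

/-- The four scalar sequences of rank at most one. -/
def S4 (k : ℕ) : Finset (Fin (k + 1) → ZMod 2) :=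
  {0, 1, fun c => if c.val = 0 then 1 else 0, fun c => if c.val = k then 1 else 0}

theorem card_S4 {k : ℕ} (hk : 3 ≤ k) : (S4 k).card = 4 := by
  have h01 : (1 : ZMod 2) ≠ 0 := by decide
  let c0 : Fin (k+1) := ⟨0, by omega⟩
  let c1 : Fin (k+1) := ⟨1, by omega⟩
  let ck : Fin (k+1) := ⟨k, by omega⟩
  have e1 : (0 : Fin (k + 1) → ZMod 2) ≠ 1 := fun h => by simpa using congrFun h c0
  have e2 : (0 : Fin (k + 1) → ZMod 2) ≠ fun c => if c.val = 0 then 1 else 0 :=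
    fun h => by simpa [c0] using congrFun h c0
  have e3 : (0 : Fin (k + 1) → ZMod 2) ≠ fun c => if c.val = k then 1 else 0 :=
    fun h => by simpa [ck] using congrFun h ck
  have e4 : (1 : Fin (k + 1) → ZMod 2) ≠ fun c => if c.val = 0 then 1 else 0 :=
    fun h => by simpa [c1] using congrFun h c1
  have e5 : (1 : Fin (k + 1) → ZMod 2) ≠ fun c => if c.val = k then 1 else 0 :=
    fun h => by
      have := congrFun h c1
      simp only [c1, Pi.one_apply, show ¬ (1 = k) by omega, if_false] at this
      exact h01 this
  have e6 : (fun c => if c.val = 0 then 1 else 0 : Fin (k + 1) → ZMod 2) ≠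
      fun c => if c.val = k then 1 else 0 :=
    fun h => by
      have := congrFun h c0
      simp only [c0, show ¬ (0 = k) by omega, if_false, if_true] at this
      exact h01 this
  unfold S4
  rw [Finset.card_insert_of_notMem, Finset.card_insert_of_notMem,
    Finset.card_insert_of_notMem, Finset.card_singleton]
  · rw [Finset.mem_singleton]; exact e6
  · rw [Finset.mem_insert, Finset.mem_singleton]; exact not_or.2 ⟨e4, e5⟩
  · rw [Finset.mem_insert, Finset.mem_insert, Finset.mem_singleton]
    exact not_or.2 ⟨e1, not_or.2 ⟨e2, e3⟩⟩

theorem line_rank {n k : ℕ} (hk : 3 ≤ k) (α : Fin n → Fin (k + 1) → ZMod 2)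
    (s : Fin n → ZMod 2) (x : ℕ → ZMod 2) (hA : ∀ c ≤ k, seqOf α c = x c • s) :
    (persymMatrix n k α).rank = 2 ↔ (s ≠ 0 ∧ (fun c : Fin (k+1) => x c.val) ∉ S4 k) := by
  have h01 : (1 : ZMod 2) ≠ 0 := by decide
  constructor
  · intro hr
    refine ⟨?_, ?_⟩
    · rintro rfl
      have := persym_rank_le_one α 0 0 0 (fun c hc => by
        rw [hA (c+1) (by omega), hA c (by omega)]; simp)
      omega
    · intro hm
      suffices (persymMatrix n k α).rank ≤ 1 by omega
      simp only [S4, Finset.mem_insert, Finset.mem_singleton] at hm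
      rcases hm with h | h | h | h
      · have hx : ∀ c ≤ k, x c = 0 := fun c hc => congrFun h ⟨c, by omega⟩
        apply persym_rank_le_one α 0 0 0
        intro c hc
        rw [hA (c+1) (by omega), hA c (by omega), hx c (by omega), hx (c+1) (by omega)]; simp
      · have hx : ∀ c ≤ k, x c = 1 := fun c hc => congrFun h ⟨c, by omega⟩
        apply persym_rank_le_one α 1 s s
        intro c hc
        rw [hA (c+1) (by omega), hA c (by omega), hx c (by omega), hx (c+1) (by omega)]; simp
      · have hx : ∀ c ≤ k, x c = if c = 0 then 1 else 0 := fun c hc => congrFun h ⟨c, by omega⟩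
        apply persym_rank_le_one α (fun c => if c = 0 then 1 else 0) s 0
        intro c hc
        rw [hA (c+1) (by omega), hA c (by omega), hx c (by omega), hx (c+1) (by omega)]; simp
      · have hx : ∀ c ≤ k, x c = if c = k then 1 else 0 := fun c hc => congrFun h ⟨c, by omega⟩
        apply persym_rank_le_one α (fun c => if c + 1 = k then 1 else 0) 0 s
        intro c hc
        rw [hA (c+1) (by omega), hA c (by omega), hx c (by omega), hx (c+1) (by omega)]
        simp [show c ≠ k by omega]
  · rintro ⟨hs, hm⟩
    apply le_antisymm
    · apply persym_rank_le_two α x (fun c => x (c+1)) s 0 0 s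
      intro c hc
      rw [hA (c+1) (by omega), hA c (by omega)]; simp
    · by_contra hlt
      apply hm
      have key := four_seq x k (by
        intro a b ha hb
        by_contra hcon
        apply hlt
        apply two_le_rank α a b ha hb
        intro e f h1 h2
        rw [hA a (by omega), hA b (by omega)] at h1
        rw [hA (a+1) (by omega), hA (b+1) (by omega)] at h2
        rw [smul_smul, smul_smul, ← add_smul, smul_eq_zero] at h1 h2
        replace h1 := h1.resolve_right hs
        replace h2 := h2.resolve_right hs
        generalize x (a+1) = p at *
        generalize x (b+1) = q at *
        generalize x a = p' at *
        generalize x b = q' at *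
        clear hA hlt hm
        revert e f p q p' q'
        decide) (by omega)
      simp only [S4, Finset.mem_insert, Finset.mem_singleton]
      rcases key with h | h | h | h
      · left; funext c; exact h c (by omega)
      · right; left; funext c; exact h c (by omega)
      · right; right; left; funext c; exact h c (by omega)
      · right; right; right; funext c; exact h c (by omega)

theorem seqOf_line {n k : ℕ} (s : Fin n → ZMod 2) (a : Fin (k + 1) → ZMod 2) :
    ∀ c ≤ k, seqOf (fun j c => s j * a c) c =
      (if h : c < k + 1 then a ⟨c, h⟩ else 0) • s := by
  intro c hc
  funext j
  simp [seqOf, show c < k + 1 by omega, mul_comm]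

theorem seqOf_form {n k : ℕ} (i : Fin 7) (s t : Fin n → ZMod 2) :
    ∀ c ≤ k, seqOf (fun j (c : Fin (k+1)) => s j * bB k i c + t j * cB k i c) c =
      bB k i c • s + cB k i c • t := by
  intro c hc
  funext j
  simp [seqOf, show c < k + 1 by omega, mul_comm]

abbrev Src (n k : ℕ) : Type :=
  ({a : Fin (k + 1) → ZMod 2 // a ∉ S4 k} × {s : Fin n → ZMod 2 // s ≠ 0}) ⊕
  (Fin 7 × {p : (Fin n → ZMod 2) × (Fin n → ZMod 2) // Ind p.1 p.2})

def mapF (n k : ℕ) : Src n k → (Fin n → Fin (k + 1) → ZMod 2)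
  | Sum.inl (a, s) => fun j c => s.1 j * a.1 c
  | Sum.inr (i, p) => fun j c => p.1.1 j * bB k i c + p.1.2 j * cB k i c

theorem mapF_rank {n k : ℕ} (hk : 3 ≤ k) (z : Src n k) :
    (persymMatrix n k (mapF n k z)).rank = 2 := by
  rcases z with ⟨a, s⟩ | ⟨i, p⟩
  · apply (line_rank hk _ s.1 _ (seqOf_line s.1 a.1)).2
    refine ⟨s.2, ?_⟩
    have : (fun c : Fin (k+1) => if h : c.val < k + 1 then a.1 ⟨c.val, h⟩ else 0) = a.1 := by
      funext c; rw [dif_pos c.isLt]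
    rw [this]; exact a.2
  · exact form_rank hk _ i p.1.1 p.1.2 p.2 (seqOf_form i p.1.1 p.1.2)

theorem mapF_surj {n k : ℕ} (hk : 3 ≤ k) (α : Fin n → Fin (k + 1) → ZMod 2)
    (h : (persymMatrix n k α).rank = 2) : ∃ z, mapF n k z = α := by
  have hval : ∀ j (c : Fin (k+1)), seqOf α c.val j = α j c := by
    intro j c; simp only [seqOf]; rw [dif_pos c.isLt]
  rcases classify hk (dep3_of_rank α h.le) with ⟨u, x, hA⟩ | ⟨i, s, t, hi, hA⟩
  · obtain ⟨hu, hx⟩ := (line_rank hk α u x hA).1 h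
    refine ⟨Sum.inl (⟨_, hx⟩, ⟨u, hu⟩), ?_⟩
    funext j c
    rw [← hval, hA c.val (by omega)]
    simp [mapF, mul_comm]
  · refine ⟨Sum.inr (i, ⟨(s, t), hi⟩), ?_⟩
    funext j c
    rw [← hval, hA c.val (by omega)]
    simp [mapF, mul_comm]

theorem not_ind_smul {ι : Type} (u : ι → ZMod 2) (e f : ZMod 2) : ¬ Ind (e • u) (f • u) := by
  rintro ⟨h1, h2, h3⟩
  rcases z2 e with rfl | rfl <;> rcases z2 f with rfl | rfl <;> simp at h1 h2 h3

/-- A form is never a line. -/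
theorem form_not_line {ι : Type} {A : ℕ → ι → ZMod 2} {k : ℕ} (hk : 3 ≤ k) {i : Fin 7}
    {s t : ι → ZMod 2} (hi : Ind s t) (hA : ∀ c ≤ k, A c = bB k i c • s + cB k i c • t)
    (hl : IsLine A k) : False := by
  obtain ⟨u, x, hx⟩ := hl
  have : ∃ p ≤ k, ∃ q ≤ k, A p = s ∧ A q = t := by
    fin_cases i
    · exact ⟨0, by omega, 1, by omega, by simp [hA 0, bB, cB], by simp [hA 1 (by omega), bB, cB]⟩
    · exact ⟨0, by omega, 1, by omega, by simp [hA 0, bB, cB], by simp [hA 1 (by omega), bB, cB]⟩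
    · exact ⟨0, by omega, 1, by omega, by simp [hA 0, bB, cB], by simp [hA 1 (by omega), bB, cB]⟩
    · exact ⟨0, by omega, 1, by omega, by simp [hA 0, bB, cB], by simp [hA 1 (by omega), bB, cB]⟩
    · exact ⟨0, by omega, k, by omega, by simp [hA 0, bB, cB, show ¬ (0 = k) by omega],
        by simp [hA k, bB, cB, show ¬ (k = 0) by omega]⟩
    · exact ⟨0, by omega, k, by omega,
        by simp [hA 0, bB, cB, show ¬ (0 = k) by omega, show 0 < k by omega],
        by simp [hA k, bB, cB]⟩
    · exact ⟨k - 1, by omega, k, by omega,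
        by simp [hA (k-1), bB, cB, show k - 1 + 1 = k by omega, show ¬ (k - 1 = k) by omega],
        by simp [hA k, bB, cB]⟩
  obtain ⟨p, hp, q, hq, rfl, rfl⟩ := this
  rw [hx p hp, hx q hq] at hi
  exact not_ind_smul _ _ _ hi

theorem form_index {ι : Type} {A : ℕ → ι → ZMod 2} {k : ℕ} (hk : 3 ≤ k) {i i' : Fin 7}
    {s t s' t' : ι → ZMod 2} (hi : Ind s t) (hi' : Ind s' t')
    (hA : ∀ c ≤ k, A c = bB k i c • s + cB k i c • t)
    (hA' : ∀ c ≤ k, A c = bB k i' c • s' + cB k i' c • t') : i = i' := by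
  have e0 := (hA 0 (by omega)).symm.trans (hA' 0 (by omega))
  have e1 := (hA 1 (by omega)).symm.trans (hA' 1 (by omega))
  have e2 := (hA 2 (by omega)).symm.trans (hA' 2 (by omega))
  clear hA hA'
  obtain ⟨h1, h2, h3⟩ := hi
  obtain ⟨h1', h2', h3'⟩ := hi'
  have n0 : ¬ (0 = k) := by omega
  have n1 : ¬ (1 = k) := by omega
  have n2 : ¬ (2 = k) := by omega
  have l0 : 0 < k := by omega
  have l1 : 1 < k := by omega
  have l2 : 2 < k := by omega
  have m0 : ¬ (1 + 1 = k) := by omega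
  fin_cases i <;> fin_cases i' <;>
    first
    | rfl
    | (exfalso
       simp [bB, cB, n0, n1, n2, l0, l1, l2] at e0 e1 e2
       first
       | exact h3' (vadd_eq _ _ e2.symm)
       | exact h3 (vadd_eq _ _ e2)
       | grind)

theorem form_unique {ι : Type} {A : ℕ → ι → ZMod 2} {k : ℕ} (hk : 3 ≤ k) {i : Fin 7}
    {s t s' t' : ι → ZMod 2}
    (hA : ∀ c ≤ k, A c = bB k i c • s + cB k i c • t)
    (hA' : ∀ c ≤ k, A c = bB k i c • s' + cB k i c • t') : s = s' ∧ t = t' := by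
  have e : ∀ c ≤ k, bB k i c • s + cB k i c • t = bB k i c • s' + cB k i c • t' :=
    fun c hc => (hA c hc).symm.trans (hA' c hc)
  have e0 := e 0 (by omega)
  have e1 := e 1 (by omega)
  have e2 := e (k-1) (by omega)
  have e3 := e k (by omega)
  clear e hA hA'
  have n0 : ¬ (0 = k) := by omega
  have n0' : ¬ (k = 0) := by omega
  have n2 : ¬ (k - 1 = k) := by omega
  have n3 : k - 1 + 1 = k := by omega
  have l0 : 0 < k := by omega
  fin_cases i
  · simp [bB, cB] at e0 e1; exact ⟨e0, e1⟩
  · simp [bB, cB] at e0 e1; exact ⟨e0, e1⟩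
  · simp [bB, cB] at e0 e1; exact ⟨e0, e1⟩
  · simp [bB, cB] at e0 e1; exact ⟨e0, e1⟩
  · simp [bB, cB, n0, n0'] at e0 e3; exact ⟨e0, e3⟩
  · simp [bB, cB, n0, l0] at e0 e3; exact ⟨e0, e3⟩
  · simp [bB, cB, n2, n3] at e2 e3; exact ⟨e2, e3⟩

theorem mapF_inj {n k : ℕ} (hk : 3 ≤ k) : Function.Injective (mapF n k) := by
  have h01 : (1 : ZMod 2) ≠ 0 := by decide
  rintro (⟨a, s⟩ | ⟨i, p⟩) (⟨a', s'⟩ | ⟨i', p'⟩) h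
  · have hh : ∀ j c, s.1 j * a.1 c = s'.1 j * a'.1 c := fun j c => congrFun (congrFun h j) c
    have ha : ∃ c, a.1 c = 1 := by
      by_contra hcon
      push Not at hcon
      apply a.2
      have : a.1 = 0 := by
        funext c; exact (z2 (a.1 c)).resolve_right (hcon c)
      rw [this]; simp [S4]
    obtain ⟨c, hc⟩ := ha
    have hs : ∃ j, s.1 j = 1 := by
      by_contra hcon
      push Not at hcon
      apply s.2
      funext j; exact (z2 (s.1 j)).resolve_right (hcon j)
    obtain ⟨j, hj⟩ := hs
    have hjc := hh j c
    rw [hj, hc] at hjc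
    have h1 : s'.1 j = 1 := by
      rcases z2 (s'.1 j) with h' | h'
      · rw [h'] at hjc; simp at hjc
      · exact h'
    have h2 : a'.1 c = 1 := by
      rcases z2 (a'.1 c) with h' | h'
      · rw [h'] at hjc; simp at hjc
      · exact h'
    have e1 : a = a' := by
      apply Subtype.ext; funext c'
      have := hh j c'
      rw [hj, h1] at this
      simpa using this
    have e2 : s = s' := by
      apply Subtype.ext; funext j'
      have := hh j' c
      rw [hc, h2] at this
      simpa using this
    rw [e1, e2]
  · exfalso
    have h1 := seqOf_form (k := k) i' p'.1.1 p'.1.2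
    have h2 := seqOf_line s.1 a.1
    change (fun j c => s.1 j * a.1 c) = (fun j (c : Fin (k+1)) => p'.1.1 j * bB k i' c + p'.1.2 j * cB k i' c) at h
    rw [h] at h2
    exact form_not_line hk p'.2 h1 ⟨_, _, h2⟩
  · exfalso
    have h1 := seqOf_form (k := k) i p.1.1 p.1.2
    have h2 := seqOf_line s'.1 a'.1
    change (fun j (c : Fin (k+1)) => p.1.1 j * bB k i c + p.1.2 j * cB k i c) = (fun j c => s'.1 j * a'.1 c) at h
    rw [← h] at h2
    exact form_not_line hk p.2 h1 ⟨_, _, h2⟩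
  · have h1 := seqOf_form (k := k) i p.1.1 p.1.2
    have h2 := seqOf_form (k := k) i' p'.1.1 p'.1.2
    change (fun j (c : Fin (k+1)) => p.1.1 j * bB k i c + p.1.2 j * cB k i c) =
      (fun j (c : Fin (k+1)) => p'.1.1 j * bB k i' c + p'.1.2 j * cB k i' c) at h
    rw [← h] at h2
    obtain rfl := form_index hk p.2 p'.2 h1 h2
    obtain ⟨e1, e2⟩ := form_unique hk h1 h2
    have : p = p' := Subtype.ext (Prod.ext e1 e2)
    rw [this]

theorem card_ind (n : ℕ) : Nat.card {p : (Fin n → ZMod 2) × (Fin n → ZMod 2) // Ind p.1 p.2} =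
    (2 ^ n - 1) * (2 ^ n - 1) - (2 ^ n - 1) := by
  classical
  have h : ∀ p : (Fin n → ZMod 2) × (Fin n → ZMod 2), Ind p.1 p.2 ↔
      p ∈ ((Finset.univ : Finset (Fin n → ZMod 2)).erase 0).offDiag := by
    intro p; simp [Ind, Finset.mem_offDiag]
  rw [Nat.card_congr (Equiv.subtypeEquivRight h), Nat.card_eq_fintype_card, Fintype.card_coe,
    Finset.offDiag_card, Finset.card_erase_of_mem (Finset.mem_univ _), Finset.card_univ]
  simp [ZMod.card]

theorem card_src {n k : ℕ} (hk : 3 ≤ k) : Nat.card (Src n k) =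
    (2 ^ (k+1) - 4) * (2 ^ n - 1) + 7 * ((2 ^ n - 1) * (2 ^ n - 1) - (2 ^ n - 1)) := by
  classical
  rw [Nat.card_sum, Nat.card_prod, Nat.card_prod, card_ind]
  have h1 : Nat.card {a : Fin (k + 1) → ZMod 2 // a ∉ S4 k} = 2 ^ (k+1) - 4 := by
    have h : ∀ a : Fin (k + 1) → ZMod 2, a ∉ S4 k ↔ a ∈ (S4 k)ᶜ := by intro a; simp
    rw [Nat.card_congr (Equiv.subtypeEquivRight h), Nat.card_eq_fintype_card, Fintype.card_coe,
      Finset.card_compl, card_S4 hk]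
    simp [ZMod.card]
  have h2 : Nat.card {s : Fin n → ZMod 2 // s ≠ 0} = 2 ^ n - 1 := by
    have h : ∀ s : Fin n → ZMod 2, s ≠ 0 ↔ s ∈ ({0} : Finset (Fin n → ZMod 2))ᶜ := by
      intro a; simp
    rw [Nat.card_congr (Equiv.subtypeEquivRight h), Nat.card_eq_fintype_card, Fintype.card_coe,
      Finset.card_compl, Finset.card_singleton]
    simp [ZMod.card]
  rw [h1, h2]
  simp

theorem gamma_two (n k : ℕ) (hn : 1 ≤ n) (hk : 3 ≤ k) :
    (Gamma n k 2 : ℤ) =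
      7 * 2 ^ (2 * n) + (2 ^ (k + 1) - 25) * 2 ^ n - 2 ^ (k + 1) + 18 := by
  have hG : Gamma n k 2 = Nat.card (Src n k) := by
    unfold Gamma
    symm
    apply Nat.card_eq_of_bijective (fun z => ⟨mapF n k z, mapF_rank hk z⟩)
    constructor
    · intro z z' h
      exact mapF_inj hk (congrArg Subtype.val h)
    · rintro ⟨α, hα⟩
      obtain ⟨z, hz⟩ := mapF_surj hk α hα
      exact ⟨z, Subtype.ext hz⟩
  rw [hG, card_src hk]
  obtain ⟨N, hN⟩ : ∃ N, 2 ^ n = N + 1 := ⟨2 ^ n - 1, by have := Nat.one_le_two_pow (n := n); omega⟩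
  obtain ⟨K, hK⟩ : ∃ K, 2 ^ (k+1) = K + 4 :=
    ⟨2 ^ (k+1) - 4, by have : 2 ^ 2 ≤ 2 ^ (k+1) := Nat.pow_le_pow_right (by norm_num) (by omega); omega⟩
  have hNZ : (2 : ℤ) ^ n = N + 1 := by exact_mod_cast hN
  have hKZ : (2 : ℤ) ^ (k+1) = K + 4 := by exact_mod_cast hK
  rw [hN, hK, mul_comm 2 n, pow_mul, hNZ, hKZ]
  simp only [Nat.add_sub_cancel]
  have hle : N ≤ N * N := Nat.le_mul_self N
  push_cast [Nat.cast_sub hle]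
  ring
end

section
/- For all integers n ≥ 1 and k ≥ 4, Γ_3(n,k) = 15·2^{3n} + (7·2^k − 133)·2^{2n} + (294 − 21·2^k)·2^n − 176 + 14·2^k (an identity of integers). -/
open Finset

open Module Submodule

abbrev EE (m : ℕ) := Fin m → ZMod 2

def LL (m : ℕ) : EE (m+1) →ₗ[ZMod 2] EE m := LinearMap.funLeft (ZMod 2) (ZMod 2) Fin.castSucc
def RR (m : ℕ) : EE (m+1) →ₗ[ZMod 2] EE m := LinearMap.funLeft (ZMod 2) (ZMod 2) Fin.succ

def DD {m : ℕ} (S : Submodule (ZMod 2) (EE (m+1))) : Submodule (ZMod 2) (EE m) :=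
  S.map (LL m) ⊔ S.map (RR m)

def VV {m : ℕ} (W : Submodule (ZMod 2) (EE m)) : Submodule (ZMod 2) (EE (m+1)) :=
  W.comap (LL m) ⊓ W.comap (RR m)

lemma DD_le_iff {m : ℕ} (S : Submodule (ZMod 2) (EE (m+1))) (W : Submodule (ZMod 2) (EE m)) :
    DD S ≤ W ↔ S ≤ VV W := by
  simp [DD, VV, Submodule.map_le_iff_le_comap]

lemma LR {m : ℕ} (z : EE (m+2)) : LL m (RR (m+1) z) = RR m (LL (m+1) z) := by
  ext i; simp [LL, RR, LinearMap.funLeft_apply]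

lemma exists_z {m : ℕ} (u v : EE (m+1)) (h : LL m u = RR m v) :
    ∃ z : EE (m+2), LL (m+1) z = v ∧ RR (m+1) z = u := by
  refine ⟨Fin.cons (v 0) u, ?_, ?_⟩
  · ext i
    refine Fin.cases ?_ (fun j => ?_) i
    · simp [LL, LinearMap.funLeft_apply]
    · have := congrFun h j
      simpa [LL, RR, LinearMap.funLeft_apply] using this
  · ext i; simp [RR, LinearMap.funLeft_apply]

lemma ext_LR {m : ℕ} (z w : EE (m+2)) (h1 : LL (m+1) z = LL (m+1) w)
    (h2 : RR (m+1) z = RR (m+1) w) : z = w := by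
  ext i
  refine Fin.cases ?_ (fun j => ?_) i
  · have := congrFun h1 0
    simpa [LL, LinearMap.funLeft_apply] using this
  · have := congrFun h2 j
    simpa [RR, LinearMap.funLeft_apply] using this

/-- rank-nullity relation -/
lemma finrank_VV {m : ℕ} (S : Submodule (ZMod 2) (EE (m+1))) :
    finrank (ZMod 2) (VV S) + finrank (ZMod 2) (DD S) = 2 * finrank (ZMod 2) S := by
  let φ : S × S →ₗ[ZMod 2] EE m :=
    ((LL m).domRestrict S).coprod (-((RR m).domRestrict S))
  have hφ : ∀ p : S × S, φ p = LL m p.1 - RR m p.2 := by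
    intro p; simp [φ, sub_eq_add_neg]
  have hr : LinearMap.range φ = DD S := by
    rw [LinearMap.range_coprod, LinearMap.range_neg, LinearMap.range_domRestrict, LinearMap.range_domRestrict]
    rfl
  have hmem : ∀ z : VV S, RR (m+1) z.1 ∈ S ∧ LL (m+1) z.1 ∈ S := fun z => ⟨z.2.2, z.2.1⟩
  let ψ : VV S →ₗ[ZMod 2] LinearMap.ker φ :=
    LinearMap.codRestrict _
      ((LinearMap.codRestrict S ((RR (m+1)).domRestrict (VV S)) (fun z => (hmem z).1)).prod
       (LinearMap.codRestrict S ((LL (m+1)).domRestrict (VV S)) (fun z => (hmem z).2)))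
      (by
        intro z
        rw [LinearMap.mem_ker, hφ]
        rw [sub_eq_zero]
        exact LR z.1)
  have hψ : Function.Bijective ψ := by
    constructor
    · intro z w h
      have h' := congrArg Subtype.val h
      have h1 := congrArg (fun p : S × S => (p.1 : EE (m+1))) h'
      have h2 := congrArg (fun p : S × S => (p.2 : EE (m+1))) h'
      exact Subtype.ext (ext_LR _ _ h2 h1)
    · rintro ⟨⟨u, v⟩, hp⟩
      rw [LinearMap.mem_ker, hφ, sub_eq_zero] at hp
      obtain ⟨z, h1, h2⟩ := exists_z _ _ hp
      refine ⟨⟨z, ?_, ?_⟩, ?_⟩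
      · change LL (m+1) z ∈ S
        rw [h1]; exact v.2
      · change RR (m+1) z ∈ S
        rw [h2]; exact u.2
      · apply Subtype.ext
        exact Prod.ext (Subtype.ext h2) (Subtype.ext h1)
  have h := LinearMap.finrank_range_add_finrank_ker φ
  rw [hr, ← (LinearEquiv.ofBijective ψ hψ).finrank_eq, finrank_prod] at h
  omega

lemma finrank_le_DD {m : ℕ} (S : Submodule (ZMod 2) (EE (m+1))) (hS : S ≠ ⊤) :
    finrank (ZMod 2) S ≤ finrank (ZMod 2) (DD S) := by
  have hker : ∀ a : EE (m+1), LL m a = 0 → a = a (Fin.last m) • Pi.single (Fin.last m) 1 := by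
    intro a ha
    ext i
    refine Fin.lastCases ?_ (fun j => ?_) i
    · simp
    · have := congrFun ha j
      simp only [LL, LinearMap.funLeft_apply, Pi.zero_apply] at this
      simp [this, Fin.castSucc_ne_last]
  have hmap : finrank (ZMod 2) (S.map (LL m)) +
      finrank (ZMod 2) (LinearMap.ker ((LL m).domRestrict S)) = finrank (ZMod 2) S := by
    have := LinearMap.finrank_range_add_finrank_ker ((LL m).domRestrict S)
    rwa [LinearMap.range_domRestrict] at this
  have hle : S.map (LL m) ≤ DD S := le_sup_left
  by_cases he : (Pi.single (Fin.last m) 1 : EE (m+1)) ∈ S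
  · have h1 : finrank (ZMod 2) (LinearMap.ker ((LL m).domRestrict S)) ≤ 1 := by
      apply finrank_le_one (⟨⟨_, he⟩, ?_⟩ : LinearMap.ker ((LL m).domRestrict S))
      · rintro ⟨⟨w, hw⟩, hw'⟩
        refine ⟨w (Fin.last m), ?_⟩
        apply Subtype.ext
        apply Subtype.ext
        exact (hker w hw').symm
      · rw [LinearMap.mem_ker]
        ext j
        simp [LL, LinearMap.funLeft_apply, Fin.castSucc_ne_last]
    rcases hle.eq_or_lt with heq | hlt
    · exfalso
      apply hS
      have hR : ∀ a ∈ S, ∃ b ∈ S, LL m b = RR m a := by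
        intro a ha
        have : RR m a ∈ DD S := (le_sup_right : S.map (RR m) ≤ DD S) (mem_map_of_mem ha)
        rw [← heq] at this
        simpa using this
      have hall : ∀ i : Fin (m+1), (Pi.single i 1 : EE (m+1)) ∈ S := by
        intro i
        induction i using Fin.reverseInduction with
        | last => exact he
        | cast i ih =>
          obtain ⟨b, hb, hb'⟩ := hR _ ih
          have hd := hker (b - Pi.single i.castSucc 1) (by
            rw [map_sub, hb', sub_eq_zero]
            ext j
            simp [LL, RR, LinearMap.funLeft_apply, Pi.single_apply])
          have : (Pi.single i.castSucc 1 : EE (m+1)) = b - (b - Pi.single i.castSucc 1) := by simp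
          rw [this, hd]
          exact S.sub_mem hb (S.smul_mem _ he)
      rw [eq_top_iff]
      intro a _
      rw [pi_eq_sum_univ' a]
      apply S.sum_mem
      intro i _
      have := S.smul_mem (a i) (hall i)
      convert this using 2
    · have := finrank_lt_finrank_of_lt hlt
      omega
  · have h0 : LinearMap.ker ((LL m).domRestrict S) = ⊥ := by
      rw [LinearMap.ker_eq_bot']
      rintro ⟨w, hw⟩ hw'
      have hk := hker w hw'
      apply Subtype.ext
      change w = 0
      by_cases hc : w (Fin.last m) = 0
      · rw [hk, hc, zero_smul]
      · exfalso
        apply he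
        rw [hk] at hw
        exact (S.smul_mem_iff hc).1 hw
    rw [h0, finrank_bot] at hmap
    have := finrank_mono hle
    omega

lemma ne_top_of_finrank {m : ℕ} {S : Submodule (ZMod 2) (EE m)}
    (h : finrank (ZMod 2) S < m) : S ≠ ⊤ := by
  rintro rfl
  simp at h

noncomputable def NN (r k : ℕ) : ℕ := Nat.card {S : Submodule (ZMod 2) (EE (k+1)) //
  finrank (ZMod 2) S = r ∧ finrank (ZMod 2) (DD S) = r}

lemma NN_succ (r k : ℕ) (h : r ≤ k) : NN r (k+1) = NN r k := by
  apply Nat.card_congr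
  refine
    { toFun := fun W => ⟨DD W.1, W.2.2, ?_⟩
      invFun := fun S => ⟨VV S.1, ?_, ?_⟩
      left_inv := ?_
      right_inv := ?_ }
  · obtain ⟨W, h1, h2⟩ := W
    have a1 := finrank_le_DD (DD W) (ne_top_of_finrank (by omega))
    have a2 := finrank_VV (DD W)
    have a3 := finrank_mono ((DD_le_iff W (DD W)).1 le_rfl)
    simp only
    omega
  · have := finrank_VV S.1
    omega
  · obtain ⟨S, h1, h2⟩ := S
    have a1 := finrank_VV S
    have a2 := finrank_le_DD (VV S) (ne_top_of_finrank (by omega))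
    have a3 := finrank_mono ((DD_le_iff (VV S) S).2 le_rfl)
    simp only
    omega
  · rintro ⟨W, h1, h2⟩
    have a1 := finrank_le_DD (DD W) (ne_top_of_finrank (by omega))
    have a2 := finrank_VV (DD W)
    have a3 := ((DD_le_iff W (DD W)).1 le_rfl)
    apply Subtype.ext
    exact (Submodule.eq_of_le_of_finrank_le a3 (by omega)).symm
  · rintro ⟨S, h1, h2⟩
    have a1 := finrank_VV S
    have a2 := finrank_le_DD (VV S) (ne_top_of_finrank (by omega))
    have a3 := ((DD_le_iff (VV S) S).2 le_rfl)
    apply Subtype.ext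
    exact (Submodule.eq_of_le_of_finrank_le a3 (h1.trans_le (a2.trans' (by omega))))

/-- Lines in a space over `F_2` correspond to nonzero vectors. -/
noncomputable def lineEquiv (V : Type*) [AddCommGroup V] [Module (ZMod 2) V]
    (P : Submodule (ZMod 2) V → Prop) :
    {z : V // z ≠ 0 ∧ P (span (ZMod 2) {z})} ≃
      {Z : Submodule (ZMod 2) V // finrank (ZMod 2) Z = 1 ∧ P Z} :=
  Equiv.ofBijective (fun z => ⟨span (ZMod 2) {z.1}, finrank_span_singleton z.2.1, z.2.2⟩) (by
    constructor
    · rintro ⟨z, hz, _⟩ ⟨w, hw, _⟩ h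
      have h' : span (ZMod 2) {z} = span (ZMod 2) {w} := congrArg Subtype.val h
      have hm : z ∈ span (ZMod 2) {w} := h' ▸ mem_span_singleton_self z
      obtain ⟨c, hc⟩ := mem_span_singleton.1 hm
      apply Subtype.ext
      change z = w
      have : c = 0 ∨ c = 1 := by clear hc; revert c; decide
      rcases this with rfl | rfl
      · simp at hc; exact absurd hc.symm hz
      · simpa using hc.symm
    · rintro ⟨Z, hZ, hP⟩
      obtain ⟨v, hv0, hv⟩ := finrank_eq_one_iff'.1 hZ
      have hs : span (ZMod 2) {v.1} = Z := by
        apply le_antisymm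
        · rw [span_singleton_le_iff_mem]; exact v.2
        · intro w hw
          obtain ⟨c, hc⟩ := hv ⟨w, hw⟩
          exact mem_span_singleton.2 ⟨c, congrArg Subtype.val hc⟩
      refine ⟨⟨v.1, ?_, ?_⟩, ?_⟩
      · simpa using hv0
      · rwa [hs]
      · exact Subtype.ext hs)

lemma card_nonzero (V : Type*) [AddCommGroup V] [Module (ZMod 2) V] [Finite V] :
    Nat.card {z : V // z ≠ 0} = 2 ^ finrank (ZMod 2) V - 1 := by
  classical
  have := Fintype.ofFinite V
  have h := Module.natCard_eq_pow_finrank (K := ZMod 2) (V := V)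
  rw [Nat.card_zmod] at h
  rw [← h, Nat.card_eq_fintype_card, Nat.card_eq_fintype_card]
  simp [Fintype.card_subtype_compl]

lemma card_lines (V : Type*) [AddCommGroup V] [Module (ZMod 2) V] [Finite V] :
    Nat.card {Z : Submodule (ZMod 2) V // finrank (ZMod 2) Z = 1} = 2 ^ finrank (ZMod 2) V - 1 := by
  rw [← card_nonzero]
  have := Nat.card_congr (lineEquiv V (fun _ => True))
  simpa using this.symm

lemma card_hyperplanes (V : Type*) [AddCommGroup V] [Module (ZMod 2) V] [Finite V] (r : ℕ)
    (hr : finrank (ZMod 2) V = r + 1) :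
    Nat.card {Z : Submodule (ZMod 2) V // finrank (ZMod 2) Z = r} = 2 ^ (r+1) - 1 := by
  have : FiniteDimensional (ZMod 2) V := Module.Finite.of_finite
  have hd : finrank (ZMod 2) (Dual (ZMod 2) V) = r + 1 := by
    rw [Subspace.dual_finrank_eq, hr]
  have : Finite (Dual (ZMod 2) V) := Module.finite_of_finite (ZMod 2)
  rw [← hd, ← card_lines]
  apply Nat.card_congr
  refine Equiv.subtypeEquiv
    ((Subspace.orderIsoFiniteDimensional (K := ZMod 2) (V := V)).toEquiv.trans OrderDual.ofDual) ?_
  intro Z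
  have := Subspace.finrank_add_finrank_dualAnnihilator_eq Z
  change _ ↔ finrank (ZMod 2) Z.dualAnnihilator = 1
  omega

lemma NN_self (r : ℕ) : NN r r = 2 ^ (r+1) - 1 := by
  rw [← card_hyperplanes (EE (r+1)) r (by simp)]
  apply Nat.card_congr
  refine Equiv.subtypeEquivRight fun S => ⟨fun h => h.1, fun h => ⟨h, ?_⟩⟩
  have h1 := finrank_le_DD S (ne_top_of_finrank (by omega))
  have h2 := Submodule.finrank_le (DD S)
  simp at h2
  omega

lemma NN_eq (r k : ℕ) (h : r ≤ k) : NN r k = 2 ^ (r+1) - 1 := by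
  induction k, h using Nat.le_induction with
  | base => exact NN_self r
  | succ k hk ih => rw [NN_succ r k hk, ih]

lemma finrank_comap_mkQ {V : Type*} [AddCommGroup V] [Module (ZMod 2) V] [Finite V]
    (C : Submodule (ZMod 2) V) (T : Submodule (ZMod 2) (V ⧸ C)) :
    finrank (ZMod 2) (T.comap C.mkQ) = finrank (ZMod 2) T + finrank (ZMod 2) C := by
  have : FiniteDimensional (ZMod 2) V := Module.Finite.of_finite
  have h := LinearMap.finrank_range_add_finrank_ker (C.mkQ.domRestrict (T.comap C.mkQ))
  rw [LinearMap.range_domRestrict, map_comap_eq_of_surjective C.mkQ_surjective,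
    LinearMap.ker_domRestrict, ker_mkQ] at h
  have hle : C ≤ T.comap C.mkQ := by
    intro c hc
    have : C.mkQ c = 0 := by simpa using hc
    rw [mem_comap, this]; exact T.zero_mem
  rw [← h]
  congr 1
  exact (Submodule.submoduleOfEquivOfLe hle).finrank_eq

lemma card_planes_over_line {V : Type*} [AddCommGroup V] [Module (ZMod 2) V] [Finite V] (k : ℕ)
    (hV : finrank (ZMod 2) V = k + 1) (C : Submodule (ZMod 2) V) (hC : finrank (ZMod 2) C = 1) :
    Nat.card {S : Submodule (ZMod 2) V // finrank (ZMod 2) S = 2 ∧ C ≤ S} = 2 ^ k - 1 := by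
  have : FiniteDimensional (ZMod 2) V := Module.Finite.of_finite
  have hq : finrank (ZMod 2) (V ⧸ C) = k := by
    have := C.finrank_quotient_add_finrank
    omega
  have : Finite (V ⧸ C) := Finite.of_surjective _ C.mkQ_surjective
  rw [← hq, ← card_lines]
  symm
  apply Nat.card_congr
  refine Equiv.ofBijective (fun T => ⟨T.1.comap C.mkQ, ?_, ?_⟩) ⟨?_, ?_⟩
  · rw [finrank_comap_mkQ, T.2, hC]
  · exact le_comap_mkQ C T.1
  · intro T T' h
    exact Subtype.ext (comap_injective_of_surjective C.mkQ_surjective (congrArg Subtype.val h))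
  · rintro ⟨S, h1, h2⟩
    have hS : (S.map C.mkQ).comap C.mkQ = S := by
      rw [comap_map_mkQ, sup_eq_right.2 h2]
    refine ⟨⟨S.map C.mkQ, ?_⟩, Subtype.ext hS⟩
    have := finrank_comap_mkQ C (S.map C.mkQ)
    rw [hS] at this
    omega

lemma finrank_DD_le {m : ℕ} (S : Submodule (ZMod 2) (EE (m+1))) :
    finrank (ZMod 2) (DD S) ≤ 2 * finrank (ZMod 2) S := by
  have := finrank_VV S
  omega

noncomputable def AA (k : ℕ) : ℕ := Nat.card {S : Submodule (ZMod 2) (EE (k+1)) //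
  finrank (ZMod 2) S = 2 ∧ finrank (ZMod 2) (DD S) = 3}

lemma AA_eq (k : ℕ) (hk : 2 ≤ k) : (AA k : ℤ) = 7 * 2 ^ k - 28 := by
  classical
  have : Fintype (Submodule (ZMod 2) (EE (k+1))) := Fintype.ofFinite _
  let s : Finset (Submodule (ZMod 2) (EE (k+1))) := univ.filter fun S => finrank (ZMod 2) S = 2
  let t : Finset (EE (k+1+1)) := univ.filter fun z => z ≠ 0
  let r : Submodule (ZMod 2) (EE (k+1)) → EE (k+1+1) → Prop := fun S z => z ∈ VV S
  have hdc := sum_card_bipartiteAbove_eq_sum_card_bipartiteBelow (s := s) (t := t) r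
  -- by planes
  have hA : ∀ S ∈ s, ((#(t.bipartiteAbove r S) : ℕ) : ℤ) =
      (if finrank (ZMod 2) (DD S) = 3 then 1 else 0) +
      3 * (if finrank (ZMod 2) (DD S) = 2 then 1 else 0) := by
    intro S hS
    have hS2 : finrank (ZMod 2) S = 2 := by simpa [s] using hS
    have hc : #(t.bipartiteAbove r S) = 2 ^ finrank (ZMod 2) (VV S) - 1 := by
      rw [← card_nonzero, ← Nat.card_eq_finsetCard]
      apply Nat.card_congr
      refine Equiv.ofBijective (fun z => ⟨⟨z.1, ?_⟩, ?_⟩) ⟨?_, ?_⟩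
      · exact (mem_bipartiteAbove r).1 z.2 |>.2
      · have := (mem_bipartiteAbove r).1 z.2 |>.1
        simp only [t, mem_filter] at this
        intro h0
        exact this.2 (congrArg Subtype.val h0)
      · intro z w h
        have h' := congrArg (fun x => (x.1.1 : EE (k+1+1))) h
        exact Subtype.ext h'
      · rintro ⟨⟨z, hz⟩, hz0⟩
        refine ⟨⟨z, (mem_bipartiteAbove r).2 ⟨?_, hz⟩⟩, rfl⟩
        simp only [t, mem_filter, mem_univ, true_and]
        rintro rfl
        exact hz0 rfl
    have h1 := finrank_VV S
    have h2 := finrank_le_DD S (ne_top_of_finrank (by omega))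
    rw [hc]
    have : finrank (ZMod 2) (DD S) = 2 ∨ finrank (ZMod 2) (DD S) = 3 ∨ finrank (ZMod 2) (DD S) = 4 := by
      omega
    rcases this with h | h | h
    · have : finrank (ZMod 2) (VV S) = 2 := by omega
      simp [h, this]
    · have : finrank (ZMod 2) (VV S) = 1 := by omega
      simp [h, this]
    · have : finrank (ZMod 2) (VV S) = 0 := by omega
      simp [h, this]
  have hB : ∀ z ∈ t, ((#(s.bipartiteBelow r z) : ℕ) : ℤ) =
      1 + (2 ^ k - 2) * (if finrank (ZMod 2) (DD (span (ZMod 2) {z})) = 1 then 1 else 0) := by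
    intro z hz
    have hz0 : z ≠ 0 := by simpa [t] using hz
    have hc : #(s.bipartiteBelow r z) = Nat.card {S : Submodule (ZMod 2) (EE (k+1)) //
        finrank (ZMod 2) S = 2 ∧ DD (span (ZMod 2) {z}) ≤ S} := by
      rw [Nat.card_eq_fintype_card, Fintype.card_subtype, bipartiteBelow, filter_filter]
      congr 1
      ext S
      simp [r, DD_le_iff]
    have h1 : finrank (ZMod 2) (span (ZMod 2) {z}) = 1 := finrank_span_singleton hz0
    have h2 := finrank_le_DD (span (ZMod 2) {z}) (ne_top_of_finrank (by omega))
    have h3 := finrank_DD_le (span (ZMod 2) {z})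
    rw [hc]
    by_cases h : finrank (ZMod 2) (DD (span (ZMod 2) {z})) = 1
    · rw [card_planes_over_line k (by simp) _ h, if_pos h, Nat.cast_sub Nat.one_le_two_pow]
      push_cast; ring
    · have h' : finrank (ZMod 2) (DD (span (ZMod 2) {z})) = 2 := by omega
      rw [if_neg h]
      have : Unique {S : Submodule (ZMod 2) (EE (k+1)) //
        finrank (ZMod 2) S = 2 ∧ DD (span (ZMod 2) {z}) ≤ S} :=
        { default := ⟨_, h', le_rfl⟩
          uniq := by
            rintro ⟨S, a, b⟩
            exact Subtype.ext (Submodule.eq_of_le_of_finrank_le b (by omega)).symm }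
      simp
  have hcast := congrArg (fun x : ℕ => (x : ℤ)) hdc
  simp only [Nat.cast_sum] at hcast
  rw [sum_congr rfl hA, sum_congr rfl hB, sum_add_distrib, sum_add_distrib, ← mul_sum, ← mul_sum,
    sum_boole, sum_boole, sum_boole, sum_const, filter_filter, filter_filter, filter_filter] at hcast
  have e1 : #{S : Submodule (ZMod 2) (EE (k+1)) | finrank (ZMod 2) S = 2 ∧
      finrank (ZMod 2) (DD S) = 3} = AA k := by
    rw [AA, Nat.card_eq_fintype_card, Fintype.card_subtype]
  have e2 : #{S : Submodule (ZMod 2) (EE (k+1)) | finrank (ZMod 2) S = 2 ∧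
      finrank (ZMod 2) (DD S) = 2} = 7 := by
    have := NN_eq 2 k hk
    rw [NN, Nat.card_eq_fintype_card, Fintype.card_subtype] at this
    simpa using this
  have e3 : #{z : EE (k+1+1) | z ≠ 0 ∧ finrank (ZMod 2) (DD (span (ZMod 2) {z})) = 1} = 3 := by
    have := NN_eq 1 (k+1) (by omega)
    rw [NN, ← Nat.card_congr (lineEquiv (EE (k+1+1)) (fun Z => finrank (ZMod 2) (DD Z) = 1)),
      Nat.card_eq_fintype_card, Fintype.card_subtype] at this
    simpa using this
  have e4 : #t = 2 ^ (k+1+1) - 1 := by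
    have := card_nonzero (EE (k+1+1))
    rw [Nat.card_eq_fintype_card, Fintype.card_subtype] at this
    simpa using this
  rw [e1, e2, e3, e4] at hcast
  rw [nsmul_eq_mul, Nat.cast_sub Nat.one_le_two_pow] at hcast
  push_cast at hcast
  rw [pow_succ, pow_succ] at hcast
  linarith

lemma span_top_iff {n s : ℕ} (γ : Fin n → EE s) :
    span (ZMod 2) (Set.range γ) = ⊤ ↔ LinearIndependent (ZMod 2) (fun i j => γ j i) := by
  have h1 : finrank (ZMod 2) (span (ZMod 2) (Set.range γ)) = (Matrix.of γ).rank :=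
    ((Matrix.of γ).rank_eq_finrank_span_row).symm
  have h2 : finrank (ZMod 2) (span (ZMod 2) (Set.range (fun (i : Fin s) (j : Fin n) => γ j i)))
      = (Matrix.of γ).rank := by
    rw [← Matrix.rank_transpose]
    exact ((Matrix.of γ).transpose.rank_eq_finrank_span_row).symm
  rw [linearIndependent_iff_card_eq_finrank_span, Set.finrank, h2, ← h1, Fintype.card_fin]
  constructor
  · intro h; rw [h]; simp
  · intro h
    apply eq_top_of_finrank_eq
    rw [← h]; simp

lemma card_indep (n s : ℕ) : (Nat.card {β : Fin s → EE n // LinearIndependent (ZMod 2) β} : ℤ) =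
    ∏ i ∈ range s, ((2:ℤ) ^ n - 2 ^ i) := by
  by_cases h : s ≤ n
  · have := card_linearIndependent (K := ZMod 2) (V := EE n) (k := s) (by simpa using h)
    rw [this, Nat.cast_prod, ← Fin.prod_univ_eq_prod_range (fun i => (2:ℤ) ^ n - 2 ^ i)]
    apply prod_congr rfl
    intro i _
    simp only [ZMod.card, finrank_fintype_fun_eq_card, Fintype.card_fin]
    rw [Nat.cast_sub (Nat.pow_le_pow_right (by norm_num) (by omega))]
    push_cast; rfl
  · rw [prod_eq_zero (i := n) (by simpa using h) (by simp)]
    have : IsEmpty {β : Fin s → EE n // LinearIndependent (ZMod 2) β} := by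
      constructor
      rintro ⟨β, hβ⟩
      have := hβ.fintype_card_le_finrank
      simp at this
      omega
    simp

lemma card_span (n s : ℕ) {V : Type*} [AddCommGroup V] [Module (ZMod 2) V] [Finite V]
    (S : Submodule (ZMod 2) V) (hS : finrank (ZMod 2) S = s) :
    (Nat.card {α : Fin n → V // span (ZMod 2) (Set.range α) = S} : ℤ) =
      ∏ i ∈ range s, ((2:ℤ) ^ n - 2 ^ i) := by
  rw [← card_indep]
  have : FiniteDimensional (ZMod 2) V := Module.Finite.of_finite
  congr 1
  let e : S ≃ₗ[ZMod 2] EE s := LinearEquiv.ofFinrankEq _ _ (by simpa using hS)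
  symm
  have hkey : ∀ γ : Fin n → EE s, span (ZMod 2) (Set.range fun j => ((e.symm (γ j) : S) : V)) =
      (span (ZMod 2) (Set.range γ)).map (S.subtype ∘ₗ e.symm.toLinearMap) := by
    intro γ
    rw [map_span, ← Set.range_comp]
    rfl
  have htop : (⊤ : Submodule (ZMod 2) (EE s)).map (S.subtype ∘ₗ e.symm.toLinearMap) = S := by
    rw [Submodule.map_top, LinearMap.range_comp, LinearEquiv.range, Submodule.map_top, range_subtype]
  have hinj : Function.Injective (S.subtype ∘ₗ e.symm.toLinearMap) :=
    S.injective_subtype.comp e.symm.injective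
  apply Nat.card_congr
  refine Equiv.ofBijective (fun β => ⟨fun j => ((e.symm (fun i => β.1 i j) : S) : V), ?_⟩) ⟨?_, ?_⟩
  · rw [hkey (fun j i => β.1 i j), (span_top_iff _).2 β.2, htop]
  · intro β β' h
    apply Subtype.ext
    funext i j
    have h1 := congrFun (congrArg Subtype.val h) j
    have h2 := hinj h1
    exact congrFun h2 i
  · rintro ⟨α, hα⟩
    have hm : ∀ j, α j ∈ S := fun j => hα ▸ subset_span ⟨j, rfl⟩
    refine ⟨⟨fun i j => e ⟨α j, hm j⟩ i, ?_⟩, ?_⟩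
    · rw [← span_top_iff (fun j => e ⟨α j, hm j⟩)]
      apply map_injective_of_injective hinj
      rw [← hkey, htop]
      simpa using hα
    · apply Subtype.ext
      funext j
      simp

lemma rank_persym (n k : ℕ) (α : Fin n → EE (k+1)) :
    (persymMatrix n k α).rank = finrank (ZMod 2) (DD (span (ZMod 2) (Set.range α))) := by
  rw [Matrix.rank_eq_finrank_span_row]
  have : span (ZMod 2) (Set.range (persymMatrix n k α).row) = DD (span (ZMod 2) (Set.range α)) := by
    apply le_antisymm
    · rw [span_le]
      rintro _ ⟨r, rfl⟩
      have hj : r.val / 2 < n := by have := r.isLt; omega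
      have hm : α ⟨r.val / 2, hj⟩ ∈ span (ZMod 2) (Set.range α) := subset_span ⟨_, rfl⟩
      rcases Nat.mod_two_eq_zero_or_one r.val with h | h
      · have : (persymMatrix n k α).row r = LL k (α ⟨r.val / 2, hj⟩) := by
          ext c
          simp only [persymMatrix, LL, Matrix.row, Matrix.of_apply, LinearMap.funLeft_apply]
          congr 1
          apply Fin.ext
          simp [h]
        rw [this]
        exact mem_sup_left (mem_map_of_mem hm)
      · have : (persymMatrix n k α).row r = RR k (α ⟨r.val / 2, hj⟩) := by
          ext c
          simp only [persymMatrix, RR, Matrix.row, Matrix.of_apply, LinearMap.funLeft_apply]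
          congr 1
          apply Fin.ext
          simp [h]; omega
        rw [this]
        exact mem_sup_right (mem_map_of_mem hm)
    · rw [DD_le_iff, span_le]
      rintro _ ⟨j, rfl⟩
      constructor
      · apply subset_span
        refine ⟨⟨2 * j.val, by omega⟩, ?_⟩
        ext c
        simp only [persymMatrix, LL, Matrix.row, Matrix.of_apply, LinearMap.funLeft_apply]
        congr 1
        · congr 1; simp
        · apply Fin.ext; simp
      · apply subset_span
        refine ⟨⟨2 * j.val + 1, by omega⟩, ?_⟩
        ext c
        simp only [persymMatrix, RR, Matrix.row, Matrix.of_apply, LinearMap.funLeft_apply]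
        congr 1
        · congr 1; change (2 * j.val + 1) / 2 = j.val; omega
        · apply Fin.ext; simp; omega
  rw [this]

theorem gamma_three (n k : ℕ) (hn : 1 ≤ n) (hk : 4 ≤ k) :
    (Gamma n k 3 : ℤ) =
      15 * 2 ^ (3 * n) + (7 * 2 ^ k - 133) * 2 ^ (2 * n)
        + (294 - 21 * 2 ^ k) * 2 ^ n - 176 + 14 * 2 ^ k := by
  classical
  have : Fintype (Submodule (ZMod 2) (EE (k+1))) := Fintype.ofFinite _
  have h1 : Gamma n k 3 = ∑ S : Submodule (ZMod 2) (EE (k+1)),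
      if finrank (ZMod 2) (DD S) = 3 then
        Nat.card {α : Fin n → EE (k+1) // span (ZMod 2) (Set.range α) = S} else 0 := by
    rw [Gamma, Nat.card_eq_fintype_card, Fintype.card_subtype,
      card_eq_sum_card_fiberwise (t := univ) (f := fun α : Fin n → EE (k+1) => span (ZMod 2) (Set.range α))
        (by intro x _; simp)]
    apply sum_congr rfl
    intro S _
    rw [filter_filter, Nat.card_eq_fintype_card, Fintype.card_subtype]
    split_ifs with h
    · congr 1
      ext α
      simp only [mem_filter, mem_univ, true_and, rank_persym]
      constructor
      · exact fun h => h.2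
      · intro h'; exact ⟨by rw [h', h], h'⟩
    · rw [card_eq_zero, filter_eq_empty_iff]
      rintro α _ ⟨h2, h3⟩
      rw [rank_persym, h3] at h2
      exact h h2
  have h2 : ∀ S : Submodule (ZMod 2) (EE (k+1)),
      (((if finrank (ZMod 2) (DD S) = 3 then
        Nat.card {α : Fin n → EE (k+1) // span (ZMod 2) (Set.range α) = S} else 0 : ℕ)) : ℤ) =
      (((2:ℤ)^n - 1) * (2^n - 2)) *
        (if finrank (ZMod 2) S = 2 ∧ finrank (ZMod 2) (DD S) = 3 then 1 else 0) +
      (((2:ℤ)^n - 1) * (2^n - 2) * (2^n - 4)) *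
        (if finrank (ZMod 2) S = 3 ∧ finrank (ZMod 2) (DD S) = 3 then 1 else 0) := by
    intro S
    by_cases h : finrank (ZMod 2) (DD S) = 3
    · have hne : S ≠ ⊤ := by
        rintro rfl
        have a : DD (⊤ : Submodule (ZMod 2) (EE (k+1))) = ⊤ := by
          rw [eq_top_iff]
          refine le_trans ?_ (le_sup_left : _ ≤ DD _)
          rw [Submodule.map_top, LinearMap.range_eq_top.2]
          exact LinearMap.funLeft_surjective_of_injective _ _ _ (Fin.castSucc_injective k)
        rw [a] at h
        simp at h
        omega
      have b1 := finrank_le_DD S hne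
      have b2 := finrank_DD_le S
      have : finrank (ZMod 2) S = 2 ∨ finrank (ZMod 2) S = 3 := by omega
      rcases this with h' | h'
      · rw [if_pos h, card_span n 2 S h']
        simp [h, h', prod_range_succ]
      · rw [if_pos h, card_span n 3 S h']
        simp [h, h', prod_range_succ]
    · simp [h]
  rw [h1, Nat.cast_sum, sum_congr rfl (fun S _ => h2 S), sum_add_distrib, ← mul_sum, ← mul_sum,
    sum_boole, sum_boole]
  have e1 : (#{S : Submodule (ZMod 2) (EE (k+1)) | finrank (ZMod 2) S = 2 ∧
      finrank (ZMod 2) (DD S) = 3} : ℤ) = 7 * 2 ^ k - 28 := by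
    rw [← AA_eq k (by omega), AA, Nat.card_eq_fintype_card, Fintype.card_subtype]
  have e2 : #{S : Submodule (ZMod 2) (EE (k+1)) | finrank (ZMod 2) S = 3 ∧
      finrank (ZMod 2) (DD S) = 3} = 15 := by
    have := NN_eq 3 k (by omega)
    rw [NN, Nat.card_eq_fintype_card, Fintype.card_subtype] at this
    simpa using this
  rw [e1, e2]
  rw [mul_comm 3 n, mul_comm 2 n, pow_mul, pow_mul]
  push_cast
  ring
end

section
/- For all integers n ≥ 1 and k ≥ 5, Γ_4(n,k) = 31·2^{4n} + ((35·2^k − 1210)/2)·2^{3n} + ((2^{2k+2} − 783·2^k + 19028)/6)·2^{2n} + (−2^{2k+1} + 269·2^k − 5744)·2^n + (2^{2k+2} − 117·2^{k+2} + 9440)/3; equivalently, 6·Γ_4(n,k) = 186·2^{4n} + 3·(35·2^k − 1210)·2^{3n} + (2^{2k+2} − 783·2^k + 19028)·2^{2n} + 6·(−2^{2k+1} + 269·2^k − 5744)·2^n + 2·(2^{2k+2} − 117·2^{k+2} + 9440) as an identity of integers. -/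
open Finset

/-- Number of continuations of a walk, computed by a transfer recursion.  The state is
`(a, b, s)`: dimension of the first projection, dimension of the vertical part, and whether
the current vertex lies in the first projection. -/
def G (X : ℤ) : ℕ → ℕ → ℕ → Bool → ℤ
  | 0, a, b, _ => if a + b = 4 then 1 else 0
  | m + 1, a, b, true => 2 ^ b * G X m a b true + (2 ^ a - 2 ^ b) * G X m a (b + 1) true
      + (X - 2 ^ a) * G X m a (b + 1) false
  | m + 1, a, b, false => 2 ^ (a + 1) * G X m (a + 1) b true
      + (X - 2 ^ (a + 1)) * G X m (a + 1) b false

lemma G_big (X : ℤ) (m : ℕ) : ∀ (a b : ℕ) (s : Bool), 4 < a + b → G X m a b s = 0 := by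
  induction m with
  | zero => intro a b s h; simp only [G]; rw [if_neg]; omega
  | succ m ih =>
    intro a b s h
    cases s
    · simp only [G]; rw [ih _ _ _ (by omega), ih _ _ _ (by omega)]; ring
    · simp only [G]; rw [ih _ _ _ h, ih _ _ _ (by omega), ih _ _ _ (by omega)]; ring

lemma G_2_2_in (X : ℤ) (j : ℕ) : 6 * G X (j+5) 2 2 true =
    (6144) * (2^j)^2 := by
  induction j with
  | zero => simp only [G]; norm_num; try ring
  | succ j ih =>
    rw [show j + 1 + 5 = (j+5)+1 by ring, G]
    have h0 := G_big X (j+5) 2 3 true (by norm_num)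
    have h1 := G_big X (j+5) 2 3 false (by norm_num)
    simp only [Nat.reduceAdd]
    linear_combination 2^2 * ih + ((2:ℤ)^2 - 2^2) * 6 * h0 + (X - 2^2) * 6 * h1

lemma G_3_1_in (X : ℤ) (j : ℕ) : 6 * G X (j+5) 3 1 true =
    (192) * 2^j := by
  induction j with
  | zero => simp only [G]; norm_num; try ring
  | succ j ih =>
    rw [show j + 1 + 5 = (j+5)+1 by ring, G]
    have h0 := G_big X (j+5) 3 2 true (by norm_num)
    have h1 := G_big X (j+5) 3 2 false (by norm_num)
    simp only [Nat.reduceAdd]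
    linear_combination 2^1 * ih + ((2:ℤ)^3 - 2^1) * 6 * h0 + (X - 2^3) * 6 * h1

lemma G_4_0_in (X : ℤ) (j : ℕ) : 6 * G X (j+5) 4 0 true =
    (6) := by
  induction j with
  | zero => simp only [G]; norm_num; try ring
  | succ j ih =>
    rw [show j + 1 + 5 = (j+5)+1 by ring, G]
    have h0 := G_big X (j+5) 4 1 true (by norm_num)
    have h1 := G_big X (j+5) 4 1 false (by norm_num)
    simp only [Nat.reduceAdd]
    linear_combination 2^0 * ih + ((2:ℤ)^4 - 2^0) * 6 * h0 + (X - 2^4) * 6 * h1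

lemma G_2_2_out (X : ℤ) (j : ℕ) : 6 * G X (j+5) 2 2 false =
    0 := by
  cases j with
  | zero => simp only [G]; norm_num; try ring
  | succ j =>
    rw [show j + 1 + 5 = (j+5)+1 by ring, G]
    have h0 := G_big X (j+5) 3 2 true (by norm_num)
    have h1 := G_big X (j+5) 3 2 false (by norm_num)
    simp only [Nat.reduceAdd]
    linear_combination (2:ℤ)^3 * 6 * h0 + (X - 2^3) * 6 * h1

lemma G_3_1_out (X : ℤ) (j : ℕ) : 6 * G X (j+5) 3 1 false =
    0 := by
  cases j with
  | zero => simp only [G]; norm_num; try ring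
  | succ j =>
    rw [show j + 1 + 5 = (j+5)+1 by ring, G]
    have h0 := G_big X (j+5) 4 1 true (by norm_num)
    have h1 := G_big X (j+5) 4 1 false (by norm_num)
    simp only [Nat.reduceAdd]
    linear_combination (2:ℤ)^4 * 6 * h0 + (X - 2^4) * 6 * h1

lemma G_4_0_out (X : ℤ) (j : ℕ) : 6 * G X (j+5) 4 0 false =
    0 := by
  cases j with
  | zero => simp only [G]; norm_num; try ring
  | succ j =>
    rw [show j + 1 + 5 = (j+5)+1 by ring, G]
    have h0 := G_big X (j+5) 5 0 true (by norm_num)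
    have h1 := G_big X (j+5) 5 0 false (by norm_num)
    simp only [Nat.reduceAdd]
    linear_combination (2:ℤ)^5 * 6 * h0 + (X - 2^5) * 6 * h1

lemma G_2_1_in (X : ℤ) (j : ℕ) : 6 * G X (j+5) 2 1 true =
    (-576) * 2^j + (6144) * (2^j)^2 + (96) * X^1 * 2^j := by
  induction j with
  | zero => simp only [G]; norm_num; try ring
  | succ j ih =>
    rw [show j + 1 + 5 = (j+5)+1 by ring, G]
    have h0 := G_2_2_in X j
    have h1 := G_2_2_out X j
    simp only [Nat.reduceAdd]
    linear_combination 2^1 * ih + ((2:ℤ)^2 - 2^1) * h0 + (X - 2^2) * h1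

lemma G_3_0_in (X : ℤ) (j : ℕ) : 6 * G X (j+5) 3 0 true =
    (-90) + (1344) * 2^j + (6) * X^1 := by
  induction j with
  | zero => simp only [G]; norm_num; try ring
  | succ j ih =>
    rw [show j + 1 + 5 = (j+5)+1 by ring, G]
    have h0 := G_3_1_in X j
    have h1 := G_3_1_out X j
    simp only [Nat.reduceAdd]
    linear_combination 2^0 * ih + ((2:ℤ)^3 - 2^0) * h0 + (X - 2^3) * h1

lemma G_1_2_out (X : ℤ) (j : ℕ) : 6 * G X (j+5) 1 2 false =
    (6144) * (2^j)^2 := by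
  cases j with
  | zero => simp only [G]; norm_num; try ring
  | succ j =>
    rw [show j + 1 + 5 = (j+5)+1 by ring, G]
    have h0 := G_2_2_in X j
    have h1 := G_2_2_out X j
    simp only [Nat.reduceAdd]
    linear_combination (2:ℤ)^2 * h0 + (X - 2^2) * h1

lemma G_2_1_out (X : ℤ) (j : ℕ) : 6 * G X (j+5) 2 1 false =
    (768) * 2^j := by
  cases j with
  | zero => simp only [G]; norm_num; try ring
  | succ j =>
    rw [show j + 1 + 5 = (j+5)+1 by ring, G]
    have h0 := G_3_1_in X j
    have h1 := G_3_1_out X j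
    simp only [Nat.reduceAdd]
    linear_combination (2:ℤ)^3 * h0 + (X - 2^3) * h1

lemma G_3_0_out (X : ℤ) (j : ℕ) : 6 * G X (j+5) 3 0 false =
    (96) := by
  cases j with
  | zero => simp only [G]; norm_num; try ring
  | succ j =>
    rw [show j + 1 + 5 = (j+5)+1 by ring, G]
    have h0 := G_4_0_in X j
    have h1 := G_4_0_out X j
    simp only [Nat.reduceAdd]
    linear_combination (2:ℤ)^4 * h0 + (X - 2^4) * h1

lemma G_1_1_in (X : ℤ) (j : ℕ) : 6 * G X (j+5) 1 1 true =
    (768) * 2^j + (-6144) * (2^j)^2 + (-480) * X^1 * 2^j + (3072) * X^1 * (2^j)^2 + (48) * X^2 * 2^j := by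
  induction j with
  | zero => simp only [G]; norm_num; try ring
  | succ j ih =>
    rw [show j + 1 + 5 = (j+5)+1 by ring, G]
    have h0 := G_1_2_out X j
    simp only [Nat.reduceAdd]
    linear_combination 2^1 * ih + (X - 2^1) * h0

lemma G_2_0_in (X : ℤ) (j : ℕ) : 6 * G X (j+5) 2 0 true =
    (468) + (-4800) * 2^j + (6144) * (2^j)^2 + (-138) * X^1 + (1056) * X^1 * 2^j + (6) * X^2 := by
  induction j with
  | zero => simp only [G]; norm_num; try ring
  | succ j ih =>
    rw [show j + 1 + 5 = (j+5)+1 by ring, G]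
    have h0 := G_2_1_in X j
    have h1 := G_2_1_out X j
    simp only [Nat.reduceAdd]
    linear_combination 2^0 * ih + ((2:ℤ)^2 - 2^0) * h0 + (X - 2^2) * h1

lemma G_1_1_out (X : ℤ) (j : ℕ) : 6 * G X (j+5) 1 1 false =
    (-2688) * 2^j + (6144) * (2^j)^2 + (576) * X^1 * 2^j := by
  cases j with
  | zero => simp only [G]; norm_num; try ring
  | succ j =>
    rw [show j + 1 + 5 = (j+5)+1 by ring, G]
    have h0 := G_2_1_in X j
    have h1 := G_2_1_out X j
    simp only [Nat.reduceAdd]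
    linear_combination (2:ℤ)^2 * h0 + (X - 2^2) * h1

lemma G_2_0_out (X : ℤ) (j : ℕ) : 6 * G X (j+5) 2 0 false =
    (-1488) + (5376) * 2^j + (144) * X^1 := by
  cases j with
  | zero => simp only [G]; norm_num; try ring
  | succ j =>
    rw [show j + 1 + 5 = (j+5)+1 by ring, G]
    have h0 := G_3_0_in X j
    have h1 := G_3_0_out X j
    simp only [Nat.reduceAdd]
    linear_combination (2:ℤ)^3 * h0 + (X - 2^3) * h1

lemma G_1_0_in (X : ℤ) (j : ℕ) : 6 * G X (j+5) 1 0 true =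
    (-1056) + (6144) * 2^j + (-6144) * (2^j)^2 + (828) * X^1 + (-4320) * X^1 * 2^j + (3072) * X^1 * (2^j)^2 + (-162) * X^2 + (624) * X^2 * 2^j + (6) * X^3 := by
  induction j with
  | zero => simp only [G]; norm_num; try ring
  | succ j ih =>
    rw [show j + 1 + 5 = (j+5)+1 by ring, G]
    have h0 := G_1_1_in X j
    have h1 := G_1_1_out X j
    simp only [Nat.reduceAdd]
    linear_combination 2^0 * ih + ((2:ℤ)^1 - 2^0) * h0 + (X - 2^1) * h1

lemma G_0_1_out (X : ℤ) (j : ℕ) : 6 * G X (j+5) 0 1 false =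
    (3456) * 2^j + (-6144) * (2^j)^2 + (-2400) * X^1 * 2^j + (3072) * X^1 * (2^j)^2 + (336) * X^2 * 2^j := by
  cases j with
  | zero => simp only [G]; norm_num; try ring
  | succ j =>
    rw [show j + 1 + 5 = (j+5)+1 by ring, G]
    have h0 := G_1_1_in X j
    have h1 := G_1_1_out X j
    simp only [Nat.reduceAdd]
    linear_combination (2:ℤ)^1 * h0 + (X - 2^1) * h1

lemma G_1_0_out (X : ℤ) (j : ℕ) : 6 * G X (j+5) 1 0 false =
    (7824) + (-20352) * 2^j + (6144) * (2^j)^2 + (-2616) * X^1 + (4800) * X^1 * 2^j + (168) * X^2 := by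
  cases j with
  | zero => simp only [G]; norm_num; try ring
  | succ j =>
    rw [show j + 1 + 5 = (j+5)+1 by ring, G]
    have h0 := G_2_0_in X j
    have h1 := G_2_0_out X j
    simp only [Nat.reduceAdd]
    linear_combination (2:ℤ)^2 * h0 + (X - 2^2) * h1

lemma G_0_0_in (X : ℤ) (j : ℕ) : 6 * G X (j+5) 0 0 true =
    (1120) + (-3456) * 2^j + (2048) * (2^j)^2 + (-1992) * X^1 + (5856) * X^1 * 2^j + (-3072) * X^1 * (2^j)^2 + (1040) * X^2 + (-2736) * X^2 * 2^j + (1024) * X^2 * (2^j)^2 + (-174) * X^3 + (336) * X^3 * 2^j + (6) * X^4 := by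
  induction j with
  | zero => simp only [G]; norm_num; try ring
  | succ j ih =>
    rw [show j + 1 + 5 = (j+5)+1 by ring, G]
    have h0 := G_0_1_out X j
    simp only [Nat.reduceAdd]
    linear_combination 2^0 * ih + (X - 2^0) * h0

lemma G_0_0_out (X : ℤ) (j : ℕ) : 6 * G X (j+5) 0 0 false =
    (-17760) + (26496) * 2^j + (-6144) * (2^j)^2 + (14712) * X^1 + (-19296) * X^1 * 2^j + (3072) * X^1 * (2^j)^2 + (-3276) * X^2 + (3024) * X^2 * 2^j + (180) * X^3 := by
  cases j with
  | zero => simp only [G]; norm_num; try ring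
  | succ j =>
    rw [show j + 1 + 5 = (j+5)+1 by ring, G]
    have h0 := G_1_0_in X j
    have h1 := G_1_0_out X j
    simp only [Nat.reduceAdd]
    linear_combination (2:ℤ)^1 * h0 + (X - 2^1) * h1

lemma zmod2_cases : ∀ t : ZMod 2, t = 0 ∨ t = 1 := by decide

section walks

variable {V : Type} [AddCommGroup V] [Module (ZMod 2) V]

/-- Span of `C` and the edges of the walk starting at `v` and continued by `w`. -/
def walkSpan (C : Submodule (ZMod 2) (V × V)) (v : V) :
    (m : ℕ) → (Fin m → V) → Submodule (ZMod 2) (V × V)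
  | 0, _ => C
  | m + 1, w => walkSpan (C ⊔ Submodule.span (ZMod 2) {(v, w 0)}) (w 0) m (Fin.tail w)

lemma walkSpan_eq (m : ℕ) : ∀ (C : Submodule (ZMod 2) (V × V)) (v : V) (w : Fin m → V),
    walkSpan C v m w = C ⊔ Submodule.span (ZMod 2) (Set.range fun i : Fin m =>
      ((Fin.cons v w : Fin (m + 1) → V) i.castSucc, (Fin.cons v w : Fin (m + 1) → V) i.succ)) := by
  induction m with
  | zero => intro C v w; simp [walkSpan]
  | succ m ih =>
    intro C v w
    rw [walkSpan, ih, sup_assoc, ← Submodule.span_union]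
    congr 2
    ext p
    simp only [Set.mem_union, Set.mem_singleton_iff, Set.mem_range, Fin.exists_fin_succ (n := m)]
    constructor
    · rintro (h | ⟨i, h⟩)
      · left; simp [h]
      · right
        refine ⟨i, ?_⟩
        rw [← h]
        simp [Fin.tail, Fin.cons_self_tail]
    · rintro (h | ⟨i, h⟩)
      · left; simp [← h]
      · right
        refine ⟨i, ?_⟩
        rw [← h]
        simp [Fin.tail, Fin.cons_self_tail]

/-- First projection. -/
def PA (C : Submodule (ZMod 2) (V × V)) : Submodule (ZMod 2) V :=
  C.map (LinearMap.fst (ZMod 2) V V)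

/-- Vertical part. -/
def PB (C : Submodule (ZMod 2) (V × V)) : Submodule (ZMod 2) V :=
  C.comap (LinearMap.inr (ZMod 2) V V)

lemma mem_PA {C : Submodule (ZMod 2) (V × V)} {x : V} : x ∈ PA C ↔ ∃ y, (x, y) ∈ C := by
  simp [PA]

lemma mem_PB {C : Submodule (ZMod 2) (V × V)} {x : V} : x ∈ PB C ↔ (0, x) ∈ C := by
  simp [PB]

lemma mem_sup_span {W : Type} [AddCommGroup W] [Module (ZMod 2) W]
    {C : Submodule (ZMod 2) W} {p x : W} :
    x ∈ C ⊔ Submodule.span (ZMod 2) {p} ↔ x ∈ C ∨ x - p ∈ C := by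
  rw [Submodule.mem_sup]
  constructor
  · rintro ⟨y, hy, z, hz, rfl⟩
    obtain ⟨t, rfl⟩ := Submodule.mem_span_singleton.1 hz
    have ht : t = 0 ∨ t = 1 := zmod2_cases t
    rcases ht with rfl | rfl
    · left; simpa using hy
    · right; simpa using hy
  · rintro (h | h)
    · exact ⟨x, h, 0, Submodule.zero_mem _, by simp⟩
    · exact ⟨x - p, h, p, Submodule.mem_span_singleton_self p, by simp⟩

variable [Fintype V]

lemma finrank_sup_span {W : Type} [AddCommGroup W] [Module (ZMod 2) W] [Finite W]
    {C : Submodule (ZMod 2) W} {p : W} (hp : p ∉ C) :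
    Module.finrank (ZMod 2) ↥(C ⊔ Submodule.span (ZMod 2) {p}) =
      Module.finrank (ZMod 2) C + 1 := by
  have hp0 : p ≠ 0 := by rintro rfl; exact hp C.zero_mem
  have h := Submodule.finrank_sup_add_finrank_inf_eq C (Submodule.span (ZMod 2) {p})
  have hd : C ⊓ Submodule.span (ZMod 2) {p} = ⊥ := by
    rw [eq_bot_iff]
    rintro x ⟨hx, hx2⟩
    obtain ⟨t, rfl⟩ := Submodule.mem_span_singleton.1 hx2
    have ht : t = 0 ∨ t = 1 := zmod2_cases t
    rcases ht with rfl | rfl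
    · simp
    · exact absurd (by simpa using hx) hp
  rw [hd, finrank_span_singleton hp0, finrank_bot] at h
  omega

lemma finrank_PA_add_PB (C : Submodule (ZMod 2) (V × V)) :
    Module.finrank (ZMod 2) (PA C) + Module.finrank (ZMod 2) (PB C) =
      Module.finrank (ZMod 2) C := by
  let f := (LinearMap.fst (ZMod 2) V V).domRestrict C
  rw [← LinearMap.finrank_range_add_finrank_ker f]
  have h1 : LinearMap.range f = PA C := LinearMap.range_domRestrict _ _
  have h2 : PB C = (LinearMap.ker f).map ((LinearMap.snd (ZMod 2) V V).domRestrict C) := by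
    ext x
    simp [mem_PB, f]
  have h3 : Function.Injective
      (((LinearMap.snd (ZMod 2) V V).domRestrict C).domRestrict (LinearMap.ker f)) := by
    rintro ⟨⟨⟨x, y⟩, hC⟩, hx⟩ ⟨⟨⟨z, t⟩, hC2⟩, hz⟩ hy
    have hx' : x = 0 := hx
    have hz' : z = 0 := hz
    have hy' : y = t := hy
    subst hx' hz' hy'
    rfl
  have h4 := LinearMap.finrank_range_of_inj h3
  rw [LinearMap.range_domRestrict] at h4
  rw [h1, h2, h4]

open Classical in
lemma sum_sub_mem (A : Submodule (ZMod 2) V) (u : V) (p : ℤ) :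
    ∑ x : V, (if x - u ∈ A then p else 0) = 2 ^ Module.finrank (ZMod 2) A * p := by
  rw [← Fintype.sum_equiv (Equiv.addRight u) (fun x => if x ∈ A then p else 0) _ (by simp)]
  rw [← Finset.sum_filter, Finset.sum_const, nsmul_eq_mul]
  congr 1
  have h := Module.card_eq_pow_finrank (K := ZMod 2) (V := A)
  rw [ZMod.card, Fintype.card_subtype] at h
  exact_mod_cast h

open Classical in
/-- Number of continuations of length `m` giving total rank 4. -/
noncomputable def cnt (m : ℕ) (C : Submodule (ZMod 2) (V × V)) (v : V) : ℤ :=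
  ∑ w : Fin m → V, if Module.finrank (ZMod 2) (walkSpan C v m w) = 4 then 1 else 0

lemma cnt_succ (m : ℕ) (C : Submodule (ZMod 2) (V × V)) (v : V) :
    cnt (m + 1) C v = ∑ v' : V, cnt m (C ⊔ Submodule.span (ZMod 2) {(v, v')}) v' := by
  unfold cnt
  rw [← Fintype.sum_prod_type']
  refine Fintype.sum_equiv (Fin.consEquiv (fun _ => V)).symm _ _ ?_
  intro w
  rfl

lemma PA_sup (C : Submodule (ZMod 2) (V × V)) (v v' : V) :
    PA (C ⊔ Submodule.span (ZMod 2) {(v, v')}) = PA C ⊔ Submodule.span (ZMod 2) {v} := by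
  simp [PA, Submodule.map_sup, Submodule.map_span]

lemma snd_sup (C : Submodule (ZMod 2) (V × V)) (v v' : V) :
    (C ⊔ Submodule.span (ZMod 2) {(v, v')}).map (LinearMap.snd (ZMod 2) V V) =
      C.map (LinearMap.snd (ZMod 2) V V) ⊔ Submodule.span (ZMod 2) {v'} := by
  simp [Submodule.map_sup, Submodule.map_span]

lemma PB_sup_out (C : Submodule (ZMod 2) (V × V)) (v v' : V) (hv : v ∉ PA C) :
    PB (C ⊔ Submodule.span (ZMod 2) {(v, v')}) = PB C := by
  ext x
  rw [mem_PB, mem_PB, mem_sup_span]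
  constructor
  · rintro (h | h)
    · exact h
    · exfalso
      apply hv
      rw [mem_PA]
      have := C.neg_mem h
      exact ⟨-(x - v'), by simpa using this⟩
  · exact Or.inl

lemma PB_sup_in (C : Submodule (ZMod 2) (V × V)) (v u v' : V) (hu : (v, u) ∈ C) :
    PB (C ⊔ Submodule.span (ZMod 2) {(v, v')}) = PB C ⊔ Submodule.span (ZMod 2) {v' - u} := by
  ext x
  rw [mem_PB, mem_sup_span, mem_sup_span, mem_PB, mem_PB]
  have : ((0, x - (v' - u)) : V × V) = ((0, x) - (v, v')) + (v, u) := by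
    ext <;> simp; abel
  rw [this, Submodule.add_mem_iff_left _ hu]

open Classical in
theorem cnt_eq (m : ℕ) : ∀ (C : Submodule (ZMod 2) (V × V)) (v : V),
    C.map (LinearMap.snd (ZMod 2) V V) ≤ PA C ⊔ Submodule.span (ZMod 2) {v} →
    cnt m C v = G (Fintype.card V) m (Module.finrank (ZMod 2) (PA C))
      (Module.finrank (ZMod 2) (PB C)) (decide (v ∈ PA C)) := by
  induction m with
  | zero =>
    intro C v _
    simp only [cnt, G, walkSpan, finrank_PA_add_PB]
    rw [Fintype.sum_unique]
    split_ifs <;> rfl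
  | succ m ih =>
    intro C v hC
    rw [cnt_succ]
    have hInv : ∀ v', (C ⊔ Submodule.span (ZMod 2) {(v, v')}).map (LinearMap.snd (ZMod 2) V V) ≤
        PA (C ⊔ Submodule.span (ZMod 2) {(v, v')}) ⊔ Submodule.span (ZMod 2) {v'} := by
      intro v'
      rw [snd_sup, PA_sup]
      exact sup_le_sup_right hC _
    by_cases hv : v ∈ PA C
    · obtain ⟨u, hu⟩ := mem_PA.1 hv
      have hA : ∀ v', PA (C ⊔ Submodule.span (ZMod 2) {(v, v')}) = PA C := by
        intro v'
        rw [PA_sup, sup_eq_left, Submodule.span_singleton_le_iff_mem]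
        exact hv
      have hS : C.map (LinearMap.snd (ZMod 2) V V) ≤ PA C := by
        rwa [sup_eq_left.2 ((Submodule.span_singleton_le_iff_mem _ _).2 hv)] at hC
      have huA : u ∈ PA C := hS ⟨(v, u), hu, rfl⟩
      have hBA : PB C ≤ PA C := fun x hx => hS ⟨(0, x), mem_PB.1 hx, rfl⟩
      set a := Module.finrank (ZMod 2) (PA C)
      set b := Module.finrank (ZMod 2) (PB C) with hb
      have key : ∀ v', cnt m (C ⊔ Submodule.span (ZMod 2) {(v, v')}) v' =
          (if v' - u ∈ PB C then
            G (Fintype.card V) m a b true - G (Fintype.card V) m a (b + 1) true else 0)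
          + (if v' - 0 ∈ PA C then
            G (Fintype.card V) m a (b + 1) true - G (Fintype.card V) m a (b + 1) false else 0)
          + G (Fintype.card V) m a (b + 1) false := by
        intro v'
        rw [ih _ _ (hInv v'), hA, PB_sup_in C v u v' hu, sub_zero]
        by_cases h : v' - u ∈ PB C
        · have h2 : v' ∈ PA C := by simpa using (PA C).add_mem (hBA h) huA
          rw [sup_eq_left.2 ((Submodule.span_singleton_le_iff_mem _ _).2 h)]
          simp only [h, h2, if_true, decide_true]
          ring
        · rw [finrank_sup_span h]
          by_cases h2 : v' ∈ PA C
          · simp only [h, h2, if_true, if_false, decide_true]; ring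
          · simp only [h, h2, if_false, decide_false]; ring
      rw [Finset.sum_congr rfl (fun v' _ => key v'), Finset.sum_add_distrib,
        Finset.sum_add_distrib, sum_sub_mem, sum_sub_mem, Finset.sum_const, Finset.card_univ,
        nsmul_eq_mul, decide_eq_true hv, G]
      ring
    · have key : ∀ v', cnt m (C ⊔ Submodule.span (ZMod 2) {(v, v')}) v' =
          (if v' - 0 ∈ PA C ⊔ Submodule.span (ZMod 2) {v} then
            G (Fintype.card V) m (Module.finrank (ZMod 2) (PA C) + 1)
              (Module.finrank (ZMod 2) (PB C)) true
            - G (Fintype.card V) m (Module.finrank (ZMod 2) (PA C) + 1)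
              (Module.finrank (ZMod 2) (PB C)) false else 0)
          + G (Fintype.card V) m (Module.finrank (ZMod 2) (PA C) + 1)
              (Module.finrank (ZMod 2) (PB C)) false := by
        intro v'
        rw [ih _ _ (hInv v'), PB_sup_out C v v' hv, PA_sup, finrank_sup_span hv, sub_zero]
        by_cases h2 : v' ∈ PA C ⊔ Submodule.span (ZMod 2) {v}
        · simp only [h2, if_true, decide_true]; ring
        · simp only [h2, if_false, decide_false]; ring
      rw [Finset.sum_congr rfl (fun v' _ => key v'), Finset.sum_add_distrib,
        sum_sub_mem, Finset.sum_const, Finset.card_univ,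
        nsmul_eq_mul, decide_eq_false hv, G, finrank_sup_span hv]
      ring

theorem cnt_bot (m : ℕ) : ∑ v : V, cnt m ⊥ v =
    G (Fintype.card V) m 0 0 true
      + ((Fintype.card V : ℤ) - 1) * G (Fintype.card V) m 0 0 false := by
  classical
  have hA : PA (⊥ : Submodule (ZMod 2) (V × V)) = ⊥ := by simp [PA]
  have hB : PB (⊥ : Submodule (ZMod 2) (V × V)) = ⊥ := by
    ext x; simp [mem_PB]
  have key : ∀ v : V, cnt m ⊥ v =
      (if v - 0 ∈ (⊥ : Submodule (ZMod 2) V) then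
        G (Fintype.card V) m 0 0 true - G (Fintype.card V) m 0 0 false else 0)
      + G (Fintype.card V) m 0 0 false := by
    intro v
    rw [cnt_eq m ⊥ v (by simp), hA, hB, finrank_bot, sub_zero]
    by_cases h2 : v ∈ (⊥ : Submodule (ZMod 2) V)
    · simp only [h2, if_true, decide_true]; ring
    · simp only [h2, if_false, decide_false]; ring
  rw [Finset.sum_congr rfl (fun v' _ => key v'), Finset.sum_add_distrib,
    sum_sub_mem, Finset.sum_const, Finset.card_univ, nsmul_eq_mul, finrank_bot]
  ring

end walks

/-- Interleaving of two vectors. -/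
def interleave (n : ℕ) : ((Fin n → ZMod 2) × (Fin n → ZMod 2)) →ₗ[ZMod 2] (Fin (2 * n) → ZMod 2) where
  toFun p r := if r.val % 2 = 0 then p.1 ⟨r.val / 2, by have := r.isLt; omega⟩
    else p.2 ⟨r.val / 2, by have := r.isLt; omega⟩
  map_add' p q := by
    ext r; dsimp only [Pi.add_apply, Prod.fst_add, Prod.snd_add]; split_ifs <;> rfl
  map_smul' c p := by
    ext r; dsimp; split_ifs <;> rfl

lemma interleave_injective (n : ℕ) : Function.Injective (interleave n) := by
  intro p q h
  ext i
  · have := congrFun h ⟨2 * i.val, by have := i.isLt; omega⟩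
    simpa [interleave] using this
  · have := congrFun h ⟨2 * i.val + 1, by have := i.isLt; omega⟩
    have e : (2 * i.val + 1) / 2 = i.val := by omega
    have e2 : (2 * i.val + 1) % 2 = 1 := by omega
    simpa [interleave, e, e2] using this

lemma rank_eq (n k : ℕ) (α : Fin n → Fin (k + 1) → ZMod 2) :
    (persymMatrix n k α).rank = Module.finrank (ZMod 2)
      (walkSpan ⊥ (fun j => α j 0) k (fun i j => α j i.succ)) := by
  rw [walkSpan_eq, bot_sup_eq, Matrix.rank_eq_finrank_span_cols,
    
    (Submodule.equivMapOfInjective (interleave n) (interleave_injective n) _).finrank_eq, Submodule.map_span]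
  rw [← Set.range_comp]
  refine congrArg (fun g : Fin k → Fin (2 * n) → ZMod 2 =>
    Module.finrank (ZMod 2) (Submodule.span (ZMod 2) (Set.range g))) ?_
  funext c r
  have e : (Fin.cons (fun j => α j 0) (fun i j => α j i.succ) : Fin (k + 1) → Fin n → ZMod 2)
      = fun i j => α j i := by
    funext i
    refine Fin.cases ?_ (fun i => ?_) i <;> simp
  simp only [Function.comp, e, interleave, persymMatrix, Matrix.col, Matrix.of_apply,
    LinearMap.coe_mk, AddHom.coe_mk, Matrix.transpose_apply]
  rcases Nat.mod_two_eq_zero_or_one r.val with h | h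
  · rw [if_pos h]; congr 1; ext; simp [h]
  · rw [if_neg (by omega)]; congr 1; ext; simp [h]; omega

lemma Gamma_eq (n k : ℕ) : (Gamma n k 4 : ℤ) = ∑ v : Fin n → ZMod 2, cnt k ⊥ v := by
  classical
  unfold Gamma cnt
  rw [Nat.card_eq_fintype_card, Fintype.card_subtype, ← Fintype.sum_prod_type',
    Finset.card_filter]
  push_cast
  refine Fintype.sum_equiv ((Equiv.piComm _).trans (Fin.consEquiv (fun _ => Fin n → ZMod 2)).symm) _ _ ?_
  intro α
  rw [rank_eq]
  rfl

theorem gamma_four (n k : ℕ) (hn : 1 ≤ n) (hk : 5 ≤ k) :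
    6 * (Gamma n k 4 : ℤ) =
      186 * 2 ^ (4 * n) + 3 * (35 * 2 ^ k - 1210) * 2 ^ (3 * n)
        + (2 ^ (2 * k + 2) - 783 * 2 ^ k + 19028) * 2 ^ (2 * n)
        + 6 * (-(2 ^ (2 * k + 1)) + 269 * 2 ^ k - 5744) * 2 ^ n
        + 2 * (2 ^ (2 * k + 2) - 117 * 2 ^ (k + 2) + 9440) := by
  obtain ⟨j, rfl⟩ := Nat.exists_eq_add_of_le' hk
  rw [Gamma_eq, cnt_bot]
  have hc : ((Fintype.card (Fin n → ZMod 2) : ℕ) : ℤ) = 2 ^ n := by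
    simp [ZMod.card]
  rw [hc]
  have h1 := G_0_0_in (2 ^ n) j
  have h0 := G_0_0_out (2 ^ n) j
  linear_combination h1 + ((2 : ℤ) ^ n - 1) * h0
end

section
/- For all integers n ≥ 1 and k ≥ 6, Γ_5(n,k) = 63·2^{5n} + ((155/4)·2^k − 2573)·2^{4n} + ((5/2)·2^{2k} − (2565/4)·2^k + 29150)·2^{3n} + (1/2)·(−35·2^{2k} + 6265·2^k − 247520)·2^{2n} + (35·2^{2k} − 5490·2^k + 203872)·2^n − 20·2^{2k} + 2960·2^k − 106752; equivalently, 4·Γ_5(n,k) equals the corresponding integer-coefficient expression obtained by clearing denominators. -/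
open Finset

open Module

namespace Persym

/-- The field with two elements. -/
abbrev F2 := ZMod 2

noncomputable instance subFintype {V : Type*} [AddCommGroup V] [Module F2 V] [Finite V] :
    Fintype (Submodule F2 V) := Fintype.ofFinite _

/-- Number of linearly independent `d`-tuples in dimension `m`. -/
def P (m d : ℕ) : ℕ := ∏ i : Fin d, (2 ^ m - 2 ^ i.val)

lemma P_zero_of_lt {m d : ℕ} (h : m < d) : P m d = 0 :=
  Finset.prod_eq_zero (Finset.mem_univ (⟨m, h⟩ : Fin d)) (by simp)

lemma P_self_pos (d : ℕ) : 0 < P d d :=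
  Finset.prod_pos fun i _ => Nat.sub_pos_of_lt (Nat.pow_lt_pow_right (by norm_num) i.isLt)

lemma card_li (V : Type*) [AddCommGroup V] [Module F2 V] [Finite V] (d : ℕ) :
    Nat.card {s : Fin d → V // LinearIndependent F2 s} = P (finrank F2 V) d := by
  by_cases h : d ≤ finrank F2 V
  · have := card_linearIndependent (K := F2) (V := V) h
    simpa [P, ZMod.card] using this
  · rw [P_zero_of_lt (by omega)]
    have : IsEmpty {s : Fin d → V // LinearIndependent F2 s} := by
      refine ⟨fun s => h ?_⟩
      simpa using s.2.fintype_card_le_finrank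
    simp

lemma card_span_top_pi (n d : ℕ) :
    Nat.card {a : Fin n → (Fin d → F2) // Submodule.span F2 (Set.range a) = ⊤} = P n d := by
  have h := card_li (Fin n → F2) d
  rw [Module.finrank_fin_fun] at h
  rw [← h]
  refine Nat.card_congr (Equiv.subtypeEquiv (Equiv.piComm _) fun a => ?_)
  have h1 := Matrix.rank_eq_finrank_span_row (R := F2) (Matrix.of a)
  have h2 := Matrix.rank_eq_finrank_span_cols (R := F2) (Matrix.of a)
  have e : (Equiv.piComm (fun (_ : Fin n) (_ : Fin d) => F2)) a = (Matrix.of a).col := rfl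
  have e' : a = (Matrix.of a).row := rfl
  rw [e, linearIndependent_iff_card_eq_finrank_span, Set.finrank, ← h2, h1, ← e']
  constructor
  · intro h; rw [h]; simp
  · intro h
    apply Submodule.eq_top_of_finrank_eq
    rw [← h]; simp

lemma card_span_top (V : Type*) [AddCommGroup V] [Module F2 V] [Finite V] (n : ℕ) :
    Nat.card {a : Fin n → V // Submodule.span F2 (Set.range a) = ⊤} = P n (finrank F2 V) := by
  rw [← card_span_top_pi]
  let e := (finBasis F2 V).equivFun
  refine Nat.card_congr (Equiv.subtypeEquiv (Equiv.piCongrRight fun _ => e.toEquiv) fun a => ?_)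
  have : Set.range ((Equiv.piCongrRight fun _ => e.toEquiv) a) = e '' Set.range a := by
    rw [← Set.range_comp]; rfl
  rw [this, ← LinearEquiv.coe_coe, Submodule.span_image]
  constructor
  · intro h; rw [h]; simp
  · intro h
    apply Submodule.map_injective_of_injective e.injective
    rw [h]; simp

lemma card_span_eq {V : Type*} [AddCommGroup V] [Module F2 V] [Finite V] (n : ℕ)
    (A : Submodule F2 V) :
    Nat.card {a : Fin n → V // Submodule.span F2 (Set.range a) = A} = P n (finrank F2 A) := by
  rw [← card_span_top]
  symm
  refine Nat.card_congr ⟨fun a => ⟨fun i => (a.1 i : V), ?_⟩,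
    fun a => ⟨fun i => ⟨a.1 i, a.2.le (Submodule.subset_span ⟨i, rfl⟩)⟩, ?_⟩,
    fun a => rfl, fun a => rfl⟩
  · have : Set.range (fun i => (a.1 i : V)) = A.subtype '' Set.range a.1 := by
      rw [← Set.range_comp]; rfl
    rw [this, Submodule.span_image, a.2]; simp
  · obtain ⟨a, rfl⟩ := a
    apply Submodule.map_injective_of_injective (Submodule.injective_subtype _)
    rw [← Submodule.span_image, ← Set.range_comp]
    simp [Function.comp_def]

/-- Gaussian binomial coefficient at `q = 2`. -/
def g (m d : ℕ) : ℕ := P m d / P d d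

open Classical in
/-- Counting tuples through their spans. -/
lemma card_tuples {V : Type*} [AddCommGroup V] [Module F2 V] [Finite V] (n : ℕ)
    (p : Submodule F2 V → Prop) [DecidablePred p] :
    Nat.card {a : Fin n → V // p (Submodule.span F2 (Set.range a))} =
      ∑ A : Submodule F2 V with p A, P n (finrank F2 A) := by
  have := Fintype.ofFinite V
  rw [Nat.card_eq_fintype_card, Fintype.card_subtype,
    Finset.card_eq_sum_card_fiberwise (f := fun a => Submodule.span F2 (Set.range a))
      (t := Finset.univ.filter p)]
  · refine Finset.sum_congr rfl fun A hA => ?_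
    rw [← card_span_eq, Nat.card_eq_fintype_card, Fintype.card_subtype, Finset.filter_filter]
    congr 1
    ext a
    simp only [Finset.mem_filter, Finset.mem_univ, true_and] at hA ⊢
    constructor
    · exact fun h => h.2
    · intro h; exact ⟨h ▸ hA, h⟩
  · intro a ha
    simpa using ha

open Classical in
lemma card_sub (V : Type*) [AddCommGroup V] [Module F2 V] [Finite V] (d : ℕ) :
    (Finset.univ.filter fun A : Submodule F2 V => finrank F2 A = d).card =
      g (finrank F2 V) d := by
  have h := card_tuples (V := V) d (fun A => finrank F2 A = d)
  have h2 : Nat.card {a : Fin d → V // finrank F2 (Submodule.span F2 (Set.range a)) = d}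
      = P (finrank F2 V) d := by
    rw [← card_li]
    refine Nat.card_congr (Equiv.subtypeEquivRight fun a => ?_)
    rw [linearIndependent_iff_card_eq_finrank_span, Set.finrank, Fintype.card_fin, eq_comm]
  rw [h2, Finset.sum_congr rfl (g := fun _ => P d d), Finset.sum_const, smul_eq_mul] at h
  · rw [g, h, Nat.mul_div_cancel _ (P_self_pos d)]
  · intro A hA
    simp only [Finset.mem_filter, Finset.mem_univ, true_and] at hA
    rw [hA]

open Classical in
lemma card_le {V : Type*} [AddCommGroup V] [Module F2 V] [Finite V] (S : Submodule F2 V) (t : ℕ) :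
    (Finset.univ.filter fun B : Submodule F2 V => finrank F2 B = t ∧ B ≤ S).card =
      g (finrank F2 S) t := by
  rw [← card_sub S t]
  symm
  refine Finset.card_bij (fun B _ => B.map S.subtype) ?_ ?_ ?_
  · intro B hB
    simp only [Finset.mem_filter, Finset.mem_univ, true_and] at hB ⊢
    exact ⟨by rw [Submodule.finrank_map_subtype_eq, hB], Submodule.map_subtype_le _ _⟩
  · intro B _ C _ h
    exact Submodule.map_injective_of_injective (Submodule.injective_subtype _) h
  · intro B hB
    simp only [Finset.mem_filter, Finset.mem_univ, true_and] at hB ⊢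
    have : (B.comap S.subtype).map S.subtype = B := by
      rw [Submodule.map_comap_subtype, inf_of_le_right hB.2]
    refine ⟨B.comap S.subtype, ?_, this⟩
    rw [← Submodule.finrank_map_subtype_eq, this, hB.1]

lemma finrank_comap_mkQ {V : Type*} [AddCommGroup V] [Module F2 V] [Finite V]
    (T : Submodule F2 V) (B : Submodule F2 (V ⧸ T)) :
    finrank F2 (B.comap T.mkQ) = finrank F2 B + finrank F2 T := by
  have h := LinearMap.finrank_range_add_finrank_ker (T.mkQ.domRestrict (B.comap T.mkQ))
  rw [LinearMap.range_domRestrict, Submodule.map_comap_eq_of_surjective T.mkQ_surjective] at h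
  rw [← h, LinearMap.ker_domRestrict, Submodule.ker_mkQ]
  congr 1
  exact (Submodule.comapSubtypeEquivOfLe (Submodule.le_comap_mkQ T B)).finrank_eq

open Classical in
lemma card_ge {V : Type*} [AddCommGroup V] [Module F2 V] [Finite V] (T : Submodule F2 V) (d : ℕ) :
    (Finset.univ.filter fun B : Submodule F2 V => finrank F2 B = d ∧ T ≤ B).card =
      if finrank F2 T ≤ d then g (finrank F2 V - finrank F2 T) (d - finrank F2 T) else 0 := by
  split_ifs with hd
  · have hq := Submodule.finrank_quotient_add_finrank T
    have : Finite (V ⧸ T) := Finite.of_surjective T.mkQ T.mkQ_surjective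
    have : finrank F2 V - finrank F2 T = finrank F2 (V ⧸ T) := by omega
    rw [this, ← card_sub (V ⧸ T)]
    symm
    refine Finset.card_bij (fun B _ => B.comap T.mkQ) ?_ ?_ ?_
    · intro B hB
      simp only [Finset.mem_filter, Finset.mem_univ, true_and] at hB ⊢
      refine ⟨by rw [finrank_comap_mkQ, hB]; omega, Submodule.le_comap_mkQ _ _⟩
    · intro B _ C _ h
      exact Submodule.comap_injective_of_surjective T.mkQ_surjective h
    · intro B hB
      simp only [Finset.mem_filter, Finset.mem_univ, true_and] at hB ⊢
      have : (B.map T.mkQ).comap T.mkQ = B := by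
        rw [Submodule.comap_map_mkQ, sup_of_le_right hB.2]
      refine ⟨B.map T.mkQ, ?_, this⟩
      have h := finrank_comap_mkQ T (B.map T.mkQ)
      rw [this] at h
      omega
  · rw [Finset.card_eq_zero, Finset.filter_eq_empty_iff]
    rintro B - ⟨h1, h2⟩
    exact hd (h1 ▸ Submodule.finrank_mono h2)

/-- Drop the last entry. -/
def L (m : ℕ) : (Fin (m + 1) → F2) →ₗ[F2] (Fin m → F2) := LinearMap.funLeft F2 F2 Fin.castSucc
/-- Drop the first entry. -/
def R (m : ℕ) : (Fin (m + 1) → F2) →ₗ[F2] (Fin m → F2) := LinearMap.funLeft F2 F2 Fin.succ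

lemma L_apply (m : ℕ) (a : Fin (m + 1) → F2) (i : Fin m) : L m a i = a i.castSucc := rfl
lemma R_apply (m : ℕ) (a : Fin (m + 1) → F2) (i : Fin m) : R m a i = a i.succ := rfl

/-- Space spanned by all the truncations. -/
def T {m : ℕ} (A : Submodule F2 (Fin (m + 1) → F2)) : Submodule F2 (Fin m → F2) :=
  A.map (L m) ⊔ A.map (R m)

/-- Words both of whose truncations lie in `A`. -/
def S {m : ℕ} (A : Submodule F2 (Fin m → F2)) : Submodule F2 (Fin (m + 1) → F2) :=
  A.comap (L m) ⊓ A.comap (R m)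

lemma T_le_iff {m : ℕ} (B : Submodule F2 (Fin (m + 1) → F2)) (A : Submodule F2 (Fin m → F2)) :
    T B ≤ A ↔ B ≤ S A := by
  simp [T, S, Submodule.map_le_iff_le_comap]

lemma finrank_S_add_T {m : ℕ} (A : Submodule F2 (Fin (m + 1) → F2)) :
    finrank F2 (T A) + finrank F2 (S A) = 2 * finrank F2 A := by
  let φ : (A × A) →ₗ[F2] (Fin m → F2) :=
    LinearMap.coprod ((L m).comp A.subtype) (-((R m).comp A.subtype))
  have hφ : ∀ x : A × A, φ x = L m x.1 - R m x.2 := by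
    intro x; simp [φ, sub_eq_add_neg]
  have h := LinearMap.finrank_range_add_finrank_ker φ
  have hr : LinearMap.range φ = T A := by
    simp only [φ, LinearMap.range_coprod, LinearMap.range_neg, LinearMap.range_comp,
      Submodule.range_subtype, T]
  let ψ : S A →ₗ[F2] (A × A) :=
    LinearMap.prod
      (LinearMap.codRestrict A ((R (m + 1)).comp (S A).subtype) fun c => c.2.2)
      (LinearMap.codRestrict A ((L (m + 1)).comp (S A).subtype) fun c => c.2.1)
  have hψ1 : ∀ c, ((ψ c).1 : Fin (m + 1) → F2) = R (m + 1) c := fun c => rfl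
  have hψ2 : ∀ c, ((ψ c).2 : Fin (m + 1) → F2) = L (m + 1) c := fun c => rfl
  have hinj : Function.Injective ψ := by
    intro c c' h
    ext i
    refine Fin.cases ?_ (fun j => ?_) i
    · have := congrFun (congrArg (fun x => (x.2 : Fin (m + 1) → F2)) h) 0
      simp only [hψ2, L_apply] at this
      exact this
    · have := congrFun (congrArg (fun x => (x.1 : Fin (m + 1) → F2)) h) j
      simp only [hψ1, R_apply] at this
      exact this
  have hk : LinearMap.range ψ = LinearMap.ker φ := by
    ext x
    rw [LinearMap.mem_ker, hφ, sub_eq_zero]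
    constructor
    · rintro ⟨c, rfl⟩
      rw [hψ1, hψ2]
      rfl
    · intro hx
      obtain ⟨⟨a, ha⟩, ⟨b, hb⟩⟩ := x
      simp only at hx
      let c : Fin (m + 2) → F2 := Fin.cons (b 0) a
      have h1 : R (m + 1) c = a := by
        ext j; simp [R_apply, c]
      have h2 : L (m + 1) c = b := by
        ext j
        refine Fin.cases ?_ (fun i => ?_) j
        · simp [L_apply, c]
        · have := congrFun hx i
          rw [L_apply, R_apply] at this
          rw [L_apply, ← this, ← Fin.succ_castSucc]
          simp [c]
      refine ⟨⟨c, ?_, ?_⟩, ?_⟩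
      · change L (m + 1) c ∈ A
        rw [h2]; exact hb
      · change R (m + 1) c ∈ A
        rw [h1]; exact ha
      · exact Prod.ext (Subtype.ext h1) (Subtype.ext h2)
  have h3 := LinearMap.finrank_range_of_inj hinj
  rw [hr, ← hk, h3, Module.finrank_prod] at h
  omega

lemma L_eq_zero {m : ℕ} {a : Fin (m + 1) → F2} (h : L m a = 0) :
    a = a (Fin.last m) • Pi.single (Fin.last m) 1 := by
  ext i
  refine Fin.lastCases ?_ (fun j => ?_) i
  · simp
  · have := congrFun h j
    rw [L_apply] at this
    simp [this]

lemma eq_top_of_single {m : ℕ} (A : Submodule F2 (Fin (m + 1) → F2))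
    (h1 : Pi.single (Fin.last m) 1 ∈ A) (h2 : A.map (R m) ≤ A.map (L m)) : A = ⊤ := by
  have key : ∀ i : Fin (m + 1), (Pi.single i 1 : Fin (m + 1) → F2) ∈ A := by
    intro i
    induction i using Fin.reverseInduction with
    | last => exact h1
    | cast i ih =>
      obtain ⟨a, ha, hL⟩ := h2 ⟨_, ih, rfl⟩
      have hz : L m (a - Pi.single i.castSucc 1) = 0 := by
        rw [map_sub, hL, sub_eq_zero]
        ext j
        rw [L_apply, R_apply]
        simp [Pi.single_apply]
      have h3 := L_eq_zero hz
      have h4 : a - Pi.single i.castSucc 1 ∈ A := by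
        rw [h3]; exact A.smul_mem _ h1
      have := A.sub_mem ha h4
      simpa using this
  rw [eq_top_iff]
  intro x _
  rw [pi_eq_sum_univ' x]
  refine A.sum_mem fun i _ => ?_
  have e : (fun j => if i = j then (1 : F2) else 0) = Pi.single i 1 := by
    ext j; simp [Pi.single_apply, eq_comm]
  exact A.smul_mem _ (e ▸ key i)

lemma finrank_T_ge {m : ℕ} (A : Submodule F2 (Fin (m + 1) → F2)) (hA : A ≠ ⊤) :
    finrank F2 A ≤ finrank F2 (T A) := by
  by_contra! hlt
  apply hA
  have hle : A.map (L m) ≤ T A := le_sup_left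
  have hmono := Submodule.finrank_mono hle
  have h := LinearMap.finrank_range_add_finrank_ker ((L m).domRestrict A)
  rw [LinearMap.range_domRestrict] at h
  have hker : LinearMap.ker ((L m).domRestrict A) ≠ ⊥ := by
    intro hb
    rw [hb, finrank_bot] at h
    omega
  obtain ⟨a, ha, hne⟩ := Submodule.exists_mem_ne_zero_of_ne_bot hker
  rw [LinearMap.mem_ker, LinearMap.domRestrict_apply] at ha
  have ha' := L_eq_zero ha
  have hs : Pi.single (Fin.last m) 1 ∈ A := by
    have hne' : (a : Fin (m + 1) → F2) (Fin.last m) ≠ 0 := by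
      intro h0
      apply hne
      apply Subtype.ext
      rw [ha', h0]; simp
    have := A.smul_mem ((a : Fin (m + 1) → F2) (Fin.last m))⁻¹ a.2
    rw [ha'] at this
    simpa [smul_smul, hne'] using this
  refine eq_top_of_single A hs ?_
  have hk1 : finrank F2 (LinearMap.ker ((L m).domRestrict A)) ≤ 1 := by
    refine finrank_le_one (⟨⟨Pi.single (Fin.last m) 1, hs⟩, ?_⟩) ?_
    · rw [LinearMap.mem_ker, LinearMap.domRestrict_apply]
      ext j
      simp [L_apply]
    · rintro ⟨b, hb⟩
      rw [LinearMap.mem_ker, LinearMap.domRestrict_apply] at hb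
      exact ⟨_, Subtype.ext (Subtype.ext (L_eq_zero hb).symm)⟩
  have : A.map (L m) = T A := Submodule.eq_of_le_of_finrank_le hle (by omega)
  rw [this]
  exact le_sup_right

open Classical in
/-- Number of `d`-dimensional subspaces of `F2^(m+1)` with `e`-dimensional truncation space. -/
noncomputable def F (m d e : ℕ) : ℕ :=
  (Finset.univ.filter fun A : Submodule F2 (Fin (m + 1) → F2) =>
    finrank F2 A = d ∧ finrank F2 (T A) = e).card

lemma ne_top_of_finrank {m d : ℕ} (hd : d ≤ m) {A : Submodule F2 (Fin (m + 1) → F2)}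
    (hA : finrank F2 A = d) : A ≠ ⊤ := by
  rintro rfl
  rw [finrank_top, Module.finrank_fin_fun] at hA
  omega

open Classical in
lemma sum_by_T (m d : ℕ) (hd : d ≤ m) (φ : ℕ → ℕ) :
    ∑ A ∈ Finset.univ.filter (fun A : Submodule F2 (Fin (m + 1) → F2) => finrank F2 A = d),
      φ (finrank F2 (T A)) =
      ∑ e ∈ Finset.Icc d (2 * d), F m d e * φ e := by
  rw [← Finset.sum_fiberwise_of_maps_to (g := fun A : Submodule F2 (Fin (m + 1) → F2) => finrank F2 (T A))
    (t := Finset.Icc d (2 * d))]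
  · refine Finset.sum_congr rfl fun e _ => ?_
    rw [Finset.sum_congr rfl (g := fun _ => φ e), Finset.sum_const, smul_eq_mul,
      Finset.filter_filter, F]
    intro A hA
    rw [(Finset.mem_filter.1 hA).2]
  · intro A hA
    have hA' := (Finset.mem_filter.1 hA).2
    have h1 := finrank_T_ge A (ne_top_of_finrank hd hA')
    have h2 := finrank_S_add_T A
    rw [Finset.mem_Icc]
    omega

open Classical in
lemma master (m d t : ℕ) (hd : d ≤ m) (ht : t ≤ m + 1) :
    ∑ e ∈ Finset.Icc d (2 * d), F m d e * g (2 * d - e) t =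
      ∑ e ∈ Finset.Icc t (2 * t),
        F (m + 1) t e * (if e ≤ d then g (m + 1 - e) (d - e) else 0) := by
  rw [← sum_by_T m d hd (fun e => g (2 * d - e) t),
    ← sum_by_T (m + 1) t ht (fun e => if e ≤ d then g (m + 1 - e) (d - e) else 0)]
  have h := Finset.sum_card_bipartiteAbove_eq_sum_card_bipartiteBelow
    (s := Finset.univ.filter fun A : Submodule F2 (Fin (m + 1) → F2) => finrank F2 A = d)
    (t := Finset.univ.filter fun B : Submodule F2 (Fin (m + 2) → F2) => finrank F2 B = t)
    (fun A B => T B ≤ A)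
  convert h using 1
  · refine Finset.sum_congr rfl fun A hA => ?_
    have hA' := (Finset.mem_filter.1 hA).2
    have h2 := finrank_S_add_T A
    have : 2 * d - finrank F2 (T A) = finrank F2 (S A) := by omega
    rw [this, ← card_le, Finset.bipartiteAbove, Finset.filter_filter]
    simp only [T_le_iff]
  · refine Finset.sum_congr rfl fun B _ => ?_
    have := card_ge (T B) d
    rw [Module.finrank_fin_fun] at this
    rw [← this, Finset.bipartiteBelow, Finset.filter_filter]

lemma g_zero (m : ℕ) : g m 0 = 1 := by simp [g, P]
lemma g_self (m : ℕ) : g m m = 1 := Nat.div_self (P_self_pos m)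
lemma g_lt {m d : ℕ} (h : m < d) : g m d = 0 := by simp [g, P_zero_of_lt h]
lemma g_one (m : ℕ) : g m 1 = 2 ^ m - 1 := by simp [g, P]
lemma g_two (m : ℕ) : g m 2 = (2 ^ m - 1) * (2 ^ m - 2) / 6 := by
  simp [g, P, Fin.prod_univ_two]

lemma F_diag_step (m d : ℕ) (hd : d ≤ m) : F (m + 1) d d = F m d d := by
  have h := master m d d hd (by omega)
  rw [Finset.sum_eq_single d, Finset.sum_eq_single d] at h
  · have e : 2 * d - d = d := by omega
    simpa [e, g_self, g_zero] using h.symm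
  · intro e he hne
    rw [Finset.mem_Icc] at he
    rw [if_neg (by omega), mul_zero]
  · intro h'; simp at h'; omega
  · intro e he hne
    rw [Finset.mem_Icc] at he
    rw [g_lt (by omega), mul_zero]
  · intro h'; simp at h'; omega

lemma F_diag_base (d : ℕ) : F d d d = g (d + 1) d := by
  have h := card_sub (Fin (d + 1) → F2) d
  rw [Module.finrank_fin_fun] at h
  rw [← h, F]
  congr 1
  ext A
  simp only [Finset.mem_filter, Finset.mem_univ, true_and, and_iff_left_iff_imp]
  intro hA
  have h1 := finrank_T_ge A (ne_top_of_finrank le_rfl hA)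
  have h2 := Submodule.finrank_le (T A)
  rw [Module.finrank_fin_fun] at h2
  omega

lemma F_diag (m d : ℕ) (hd : d ≤ m) : F m d d = g (d + 1) d := by
  induction m, hd using Nat.le_induction with
  | base => exact F_diag_base d
  | succ m hm ih => rw [F_diag_step m d hm, ih]

lemma F11 (m : ℕ) (h : 1 ≤ m) : F m 1 1 = 3 := (F_diag m 1 h).trans (by decide)
lemma F22 (m : ℕ) (h : 2 ≤ m) : F m 2 2 = 7 := (F_diag m 2 h).trans (by decide)
lemma F33 (m : ℕ) (h : 3 ≤ m) : F m 3 3 = 15 := (F_diag m 3 h).trans (by decide)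
lemma F44 (m : ℕ) (h : 4 ≤ m) : F m 4 4 = 31 := (F_diag m 4 h).trans (by decide)
lemma F55 (m : ℕ) (h : 5 ≤ m) : F m 5 5 = 63 := (F_diag m 5 h).trans (by simp [g, P, Fin.prod_univ_succ])

lemma g_one_q (m : ℕ) : (g m 1 : ℚ) = 2 ^ m - 1 := by
  rw [g_one, Nat.cast_sub Nat.one_le_two_pow]; simp

lemma P_cast (m d : ℕ) : (P m d : ℚ) = ∏ i : Fin d, ((2 : ℚ) ^ m - 2 ^ i.val) := by
  by_cases h : m < d
  · rw [P_zero_of_lt h, Finset.prod_eq_zero (Finset.mem_univ (⟨m, h⟩ : Fin d)) (by simp)]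
    simp
  · rw [P, Nat.cast_prod]
    refine Finset.prod_congr rfl fun i _ => ?_
    rw [Nat.cast_sub (Nat.pow_le_pow_right (by norm_num) (by omega))]
    simp

open Classical in
lemma g_mul (m d : ℕ) : g m d * P d d = P m d := by
  have h := card_tuples (V := Fin m → F2) d (fun A => finrank F2 A = d)
  have h2 : Nat.card {a : Fin d → (Fin m → F2) //
      finrank F2 (Submodule.span F2 (Set.range a)) = d} = P m d := by
    have h3 := card_li (Fin m → F2) d
    rw [Module.finrank_fin_fun] at h3
    rw [← h3]
    refine Nat.card_congr (Equiv.subtypeEquivRight fun a => ?_)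
    rw [linearIndependent_iff_card_eq_finrank_span, Set.finrank, Fintype.card_fin, eq_comm]
  rw [h2, Finset.sum_congr rfl (g := fun _ => P d d), Finset.sum_const, smul_eq_mul] at h
  · rw [g, h, Nat.mul_div_cancel _ (P_self_pos d)]
  · intro A hA
    simp only [Finset.mem_filter, Finset.mem_univ, true_and] at hA
    rw [hA]

lemma g_two_q (m : ℕ) : (g m 2 : ℚ) = (2 ^ m - 1) * (2 ^ m - 2) / 6 := by
  have h := g_mul m 2
  have h' : (g m 2 : ℚ) * P 2 2 = P m 2 := by exact_mod_cast h
  rw [P_cast, P_cast] at h'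
  simp only [Fin.prod_univ_two] at h'
  norm_num at h'
  linarith

lemma F12 (m : ℕ) (h : 1 ≤ m) : (F m 1 2 : ℚ) = 2 ^ (m + 1) - 4 := by
  have h1 := sum_by_T m 1 h (fun _ => 1)
  have h2 := card_sub (Fin (m + 1) → F2) 1
  rw [Module.finrank_fin_fun] at h2
  rw [Finset.sum_const, smul_eq_mul, mul_one] at h1
  have h3 : (Finset.Icc 1 (2 * 1)) = {1, 2} := by decide
  rw [h3, Finset.sum_pair (by norm_num), F11 m h] at h1
  have h4 : (g (m + 1) 1 : ℚ) = (3 : ℕ) + F m 1 2 := by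
    rw [← h2]
    have : ((3 * 1 + F m 1 2 * 1 : ℕ) : ℚ) = (3 : ℕ) + F m 1 2 := by push_cast; ring
    rw [← this, ← h1]
  rw [g_one_q] at h4
  push_cast at h4
  linarith

lemma F23 (m : ℕ) (h : 2 ≤ m) : (F m 2 3 : ℚ) = 7 * 2 ^ m - 28 := by
  have h1 := master m 2 1 h (by omega)
  rw [show Finset.Icc 2 (2 * 2) = {2, 3, 4} by decide,
    show Finset.Icc 1 (2 * 1) = {1, 2} by decide] at h1
  simp [F22 m h, F11 (m + 1) (by omega), show g 2 1 = 3 by decide, g_self, g_zero,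
    show g 0 1 = 0 by decide] at h1
  have h2 := congrArg (Nat.cast : ℕ → ℚ) h1
  push_cast at h2
  rw [g_one_q, F12 (m + 1) (by omega)] at h2
  rw [pow_succ, pow_succ] at h2
  linarith

lemma F34 (m : ℕ) (h : 3 ≤ m) : (F m 3 4 : ℚ) = 35 * 2 ^ (m - 1) - 140 := by
  have h1 := master m 3 2 h (by omega)
  rw [show Finset.Icc 3 (2 * 3) = {3, 4, 5, 6} by decide,
    show Finset.Icc 2 (2 * 2) = {2, 3, 4} by decide] at h1
  simp [F33 m h, F22 (m + 1) (by omega), show g 3 2 = 7 by decide, g_self, g_zero,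
    show g 1 2 = 0 by decide, show g 0 2 = 0 by decide] at h1
  have h2 := congrArg (Nat.cast : ℕ → ℚ) h1
  push_cast at h2
  obtain ⟨m, rfl⟩ : ∃ j, m = j + 1 := ⟨m - 1, by omega⟩
  simp only [Nat.add_sub_cancel] at h2 ⊢
  rw [F23 (m + 1 + 1) (by omega), g_one_q] at h2
  rw [pow_succ, pow_succ] at h2
  linarith

lemma F45 (m : ℕ) (h : 4 ≤ m) : (F m 4 5 : ℚ) = 155 * 2 ^ (m - 2) - 620 := by
  have h1 := master m 4 3 h (by omega)
  rw [show Finset.Icc 4 (2 * 4) = {4, 5, 6, 7, 8} by decide,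
    show Finset.Icc 3 (2 * 3) = {3, 4, 5, 6} by decide] at h1
  simp [F44 m h, F33 (m + 1) (by omega), show g 4 3 = 15 by decide, g_self, g_zero,
    show g 2 3 = 0 by decide, show g 1 3 = 0 by decide, show g 0 3 = 0 by decide] at h1
  have h2 := congrArg (Nat.cast : ℕ → ℚ) h1
  push_cast at h2
  obtain ⟨m, rfl⟩ : ∃ j, m = j + 2 := ⟨m - 2, by omega⟩
  simp only [Nat.add_sub_cancel] at h2 ⊢
  rw [F34 (m + 2 + 1) (by omega), show m + 2 + 1 - 1 = m + 2 by omega, g_one_q] at h2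
  rw [pow_succ, pow_succ] at h2
  linarith

lemma F35 (m : ℕ) (h : 3 ≤ m) : (F m 3 5 : ℚ) =
    (2 ^ m - 1) * (2 ^ m - 2) / 2 + (2 ^ (m + 2) - 4) * (2 ^ (m - 1) - 1)
      - 3 * (35 * 2 ^ (m - 1) - 140) - 105 := by
  have h1 := master m 3 1 h (by omega)
  rw [show Finset.Icc 3 (2 * 3) = {3, 4, 5, 6} by decide,
    show Finset.Icc 1 (2 * 1) = {1, 2} by decide] at h1
  simp [F33 m h, F11 (m + 1) (by omega), show g 3 1 = 7 by decide,
    show g 2 1 = 3 by decide, g_self, show g 0 1 = 0 by decide] at h1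
  have h2 := congrArg (Nat.cast : ℕ → ℚ) h1
  push_cast at h2
  rw [F34 m h, F12 (m + 1) (by omega), g_two_q, g_one_q] at h2
  linarith

lemma rank_eq (n k : ℕ) (α : Fin n → Fin (k + 1) → ZMod 2) :
    (persymMatrix n k α).rank = finrank F2 (T (Submodule.span F2 (Set.range α))) := by
  rw [Matrix.rank_eq_finrank_span_row]
  have : Submodule.span F2 (Set.range (persymMatrix n k α).row) =
      T (Submodule.span F2 (Set.range α)) := by
    rw [T, Submodule.map_span, Submodule.map_span, ← Submodule.span_union]
    congr 1
    ext v
    simp only [Set.mem_union, Set.mem_image, Set.mem_range, exists_exists_eq_and]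
    constructor
    · rintro ⟨r, rfl⟩
      rcases Nat.mod_two_eq_zero_or_one r.val with h | h
      · refine Or.inl ⟨⟨r.val / 2, by omega⟩, ?_⟩
        ext c
        simp only [L_apply, persymMatrix, Matrix.row, Matrix.of_apply]
        congr 1
        apply Fin.ext
        simp [h]
      · refine Or.inr ⟨⟨r.val / 2, by omega⟩, ?_⟩
        ext c
        simp only [R_apply, persymMatrix, Matrix.row, Matrix.of_apply]
        congr 1
        apply Fin.ext
        simp [h, add_comm]
    · rintro (⟨j, rfl⟩ | ⟨j, rfl⟩)
      · refine ⟨⟨2 * j.val, by omega⟩, ?_⟩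
        ext c
        simp only [L_apply, persymMatrix, Matrix.row, Matrix.of_apply]
        congr 1
        · congr 1
          simp
        · apply Fin.ext
          simp
      · refine ⟨⟨2 * j.val + 1, by omega⟩, ?_⟩
        ext c
        simp only [R_apply, persymMatrix, Matrix.row, Matrix.of_apply]
        congr 1
        · congr 1
          omega
        · apply Fin.ext
          simp only [Fin.val_succ]
          omega
  rw [this]

open Classical in
lemma Gamma_eq (n k : ℕ) (hk : 6 ≤ k) :
    Gamma n k 5 = F k 3 5 * P n 3 + F k 4 5 * P n 4 + F k 5 5 * P n 5 := by
  have h := card_tuples (V := Fin (k + 1) → F2) n (fun A => finrank F2 (T A) = 5)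
  have h0 : Gamma n k 5 = Nat.card {a : Fin n → (Fin (k + 1) → F2) //
      finrank F2 (T (Submodule.span F2 (Set.range a))) = 5} := by
    rw [Gamma]
    refine Nat.card_congr (Equiv.subtypeEquivRight fun a => ?_)
    rw [rank_eq]
  rw [h0, h, ← Finset.sum_fiberwise_of_maps_to
    (g := fun A : Submodule F2 (Fin (k + 1) → F2) => finrank F2 A) (t := {3, 4, 5})]
  · have key : ∀ d, ∑ A ∈ (Finset.univ.filter fun A : Submodule F2 (Fin (k + 1) → F2) =>
        finrank F2 (T A) = 5).filter (fun A : Submodule F2 (Fin (k + 1) → F2) =>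
          finrank F2 A = d), P n (finrank F2 A) = F k d 5 * P n d := by
      intro d
      rw [Finset.sum_congr rfl (g := fun _ => P n d), Finset.sum_const, smul_eq_mul,
        Finset.filter_filter, F]
      · simp only [and_comm]
      · intro A hA
        rw [(Finset.mem_filter.1 hA).2]
    rw [Finset.sum_congr rfl (fun d _ => key d)]
    simp [add_assoc]
  · intro A hA
    have hA' : finrank F2 (T A) = 5 := (Finset.mem_filter.1 hA).2
    have hne : A ≠ ⊤ := by
      rintro rfl
      have h1 : T (⊤ : Submodule F2 (Fin (k + 1) → F2)) = ⊤ := by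
        rw [T, eq_top_iff]
        refine le_trans ?_ le_sup_left
        rw [Submodule.map_top, LinearMap.range_eq_top.2]
        exact LinearMap.funLeft_surjective_of_injective _ _ _ (Fin.castSucc_injective k)
      rw [h1, finrank_top, Module.finrank_fin_fun] at hA'
      omega
    have h1 := finrank_T_ge A hne
    have h2 := finrank_S_add_T A
    have h3 : finrank F2 A = 3 ∨ finrank F2 A = 4 ∨ finrank F2 A = 5 := by omega
    simpa using h3

end Persym

open Persym in
theorem gamma_five (n k : ℕ) (hn : 1 ≤ n) (hk : 6 ≤ k) :
    (Gamma n k 5 : ℚ) =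
      63 * 2 ^ (5 * n) + ((155 / 4) * 2 ^ k - 2573) * 2 ^ (4 * n)
        + ((5 / 2) * 2 ^ (2 * k) - (2565 / 4) * 2 ^ k + 29150) * 2 ^ (3 * n)
        + (1 / 2) * (-(35 * 2 ^ (2 * k)) + 6265 * 2 ^ k - 247520) * 2 ^ (2 * n)
        + (35 * 2 ^ (2 * k) - 5490 * 2 ^ k + 203872) * 2 ^ n
        - 20 * 2 ^ (2 * k) + 2960 * 2 ^ k - 106752 := by
  rw [Gamma_eq n k hk]
  push_cast
  rw [F35 k (by omega), F45 k (by omega), F55 k (by omega), P_cast, P_cast, P_cast]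
  simp only [Fin.prod_univ_succ, Fin.prod_univ_zero, Fin.val_zero, Fin.val_succ, pow_zero]
  obtain ⟨j, rfl⟩ : ∃ j, k = j + 2 := ⟨k - 2, by omega⟩
  simp only [Nat.add_sub_cancel, show j + 2 - 1 = j + 1 by omega]
  have h5 : (2 : ℚ) ^ (5 * n) = (2 ^ n) ^ 5 := by rw [mul_comm, pow_mul]
  have h4 : (2 : ℚ) ^ (4 * n) = (2 ^ n) ^ 4 := by rw [mul_comm, pow_mul]
  have h3 : (2 : ℚ) ^ (3 * n) = (2 ^ n) ^ 3 := by rw [mul_comm, pow_mul]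
  have h2 : (2 : ℚ) ^ (2 * n) = (2 ^ n) ^ 2 := by rw [mul_comm, pow_mul]
  have hj : (2 : ℚ) ^ (2 * (j + 2)) = (2 ^ (j + 2)) ^ 2 := by rw [mul_comm, pow_mul]
  rw [h5, h4, h3, h2, hj]
  simp only [pow_add]
  generalize (2 : ℚ) ^ n = x
  generalize (2 : ℚ) ^ j = y
  norm_num
  ring
end
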